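/- arXiv:2407.06878 — 4 statements merged into one kernel-verified Lean document; each statement's English description precedes it below -/
import Mathlib

section
/- Let A be the 5×5 reciprocal matrix with rows (1, 1, a_13, a_14, 1), (1, 1, 1, a_24, 1), (1/a_13, 1, 1, 1, 1), (1/a_14, 1/a_24, 1, 1, 1), (1, 1, 1, 1, 1), where a_13, a_14, a_24 > 0. If (1 < a_24 < a_14 < a_13) or (a_24 < 1 < a_13 < a_14), then C(A) is not contained in E(A), i.e., there exists a vector in C(A) that is not efficient for A. -/
open Matrix

/-- An `n × n` real matrix is *reciprocal* if all its entries are positive and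
`A j i = 1 / A i j` for all `i, j`. -/
def IsReciprocal {n : ℕ} (A : Matrix (Fin n) (Fin n) ℝ) : Prop :=
  (∀ i j, 0 < A i j) ∧ ∀ i j, A j i = 1 / A i j

/-- A positive vector `w` is *efficient* for `A` if every positive vector `v` whose
associated consistent matrix approximates `A` at least as well entrywise is
proportional to `w`. -/
def IsEfficient {n : ℕ} (A : Matrix (Fin n) (Fin n) ℝ) (w : Fin n → ℝ) : Prop :=
  (∀ i, 0 < w i) ∧
    ∀ v : Fin n → ℝ, (∀ i, 0 < v i) →
      (∀ i j, |A i j - v i / v j| ≤ |A i j - w i / w j|) → ∃ c : ℝ, v = c • w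

/-- The set of efficient vectors for `A`. -/
def EffSet {n : ℕ} (A : Matrix (Fin n) (Fin n) ℝ) : Set (Fin n → ℝ) :=
  {w | IsEfficient A w}

/-- The cone generated by the columns of `A`: nonzero vectors of the form `A · u`
with `u` entrywise nonnegative. -/
def ConeCols {n : ℕ} (A : Matrix (Fin n) (Fin n) ℝ) : Set (Fin n → ℝ) :=
  {w | w ≠ 0 ∧ ∃ u : Fin n → ℝ, (∀ i, 0 ≤ u i) ∧ w = A.mulVec u}

/-- A *monomial* matrix: the product of a permutation matrix and a diagonal matrix
with positive diagonal entries. -/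
def IsMonomial {n : ℕ} (S : Matrix (Fin n) (Fin n) ℝ) : Prop :=
  ∃ (σ : Equiv.Perm (Fin n)) (d : Fin n → ℝ), (∀ i, 0 < d i) ∧
    S = σ.permMatrix ℝ * Matrix.diagonal d

/-- If index `k` satisfies `w k < A k j * w j` strictly for all `j ≠ k`, then `w` is not efficient. -/
theorem not_efficient_of_sink {n : ℕ} (A : Matrix (Fin n) (Fin n) ℝ)
    (hpos : ∀ i j, 0 < A i j) (hrec : ∀ i j, A j i = 1 / A i j)
    (w : Fin n → ℝ) (k l : Fin n) (hl : l ≠ k)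
    (h : ∀ j, j ≠ k → w k < A k j * w j) : ¬ IsEfficient A w := by
  rintro ⟨hw, hE⟩
  have hev : ∀ᶠ x in nhdsWithin (w k) (Set.Ioi (w k)), ∀ j, j ≠ k → x < A k j * w j := by
    rw [Filter.eventually_all]
    intro j
    by_cases hj : j = k
    · simp [hj]
    · have := (eventually_lt_nhds (h j hj)).filter_mono
        (nhdsWithin_le_nhds (s := Set.Ioi (w k)))
      filter_upwards [this] with x hx _
      exact hx
  obtain ⟨x, hx, hxk⟩ := (hev.and self_mem_nhdsWithin).exists
  have hxk : w k < x := hxk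
  have hx0 : 0 < x := (hw k).trans hxk
  obtain ⟨c, hc⟩ := hE (Function.update w k x)
    (by
      intro i
      by_cases hi : i = k
      · subst hi; simpa using hx0
      · simpa [Function.update_of_ne hi] using hw i)
    (by
      intro i j
      by_cases hi : i = k
      · by_cases hj : j = k
        · subst hi; subst hj
          simp [div_self hx0.ne', div_self (hw j).ne']
        · subst hi
          rw [Function.update_self, Function.update_of_ne hj]
          have h1 : w i / w j ≤ x / w j := div_le_div_of_nonneg_right hxk.le (hw j).le
          have h2 : x / w j ≤ A i j := by
            rw [div_le_iff₀ (hw j)]; exact (hx j hj).le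
          rw [abs_of_nonneg (by linarith), abs_of_nonneg (by linarith)]
          linarith
      · by_cases hj : j = k
        · subst hj
          rw [Function.update_self, Function.update_of_ne hi]
          have h1 : w i / x ≤ w i / w j := div_le_div_of_nonneg_left (hw i).le (hw j) hxk.le
          have h2 : A i j ≤ w i / x := by
            rw [hrec j i, div_le_div_iff₀ (hpos j i) hx0]
            linarith [hx i hi]
          rw [abs_of_nonpos (by linarith), abs_of_nonpos (by linarith)]
          linarith
        · rw [Function.update_of_ne hi, Function.update_of_ne hj])
  have e1 := congrFun hc l
  have e2 := congrFun hc k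
  rw [Function.update_of_ne hl] at e1
  simp only [Function.update_self, Pi.smul_apply, smul_eq_mul] at e1 e2
  have hc1 : c = 1 := by
    have := (hw l).ne'
    field_simp at e1
    exact e1.symm
  rw [hc1] at e2
  linarith

/-- Lemma l5caineaconv: necessity. -/
theorem not_coneCols_subset_effSet_five (a13 a14 a24 : ℝ)
    (h13 : 0 < a13) (h14 : 0 < a14) (h24 : 0 < a24)
    (hcond : (1 < a24 ∧ a24 < a14 ∧ a14 < a13) ∨ (a24 < 1 ∧ 1 < a13 ∧ a13 < a14)) :
    ¬ ConeCols !![1, 1, a13, a14, 1; 1, 1, 1, a24, 1; 1 / a13, 1, 1, 1, 1; 1 / a14, 1 / a24, 1, 1, 1; 1, 1, 1, 1, 1] ⊆ EffSet !![1, 1, a13, a14, 1; 1, 1, 1, a24, 1; 1 / a13, 1, 1, 1, 1; 1 / a14, 1 / a24, 1, 1, 1; 1, 1, 1, 1, 1] := by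
  intro hsub
  have hpos : ∀ i j, 0 < !![1, 1, a13, a14, 1; 1, 1, 1, a24, 1; 1 / a13, 1, 1, 1, 1; 1 / a14, 1 / a24, 1, 1, 1; 1, 1, 1, 1, 1] i j := by
    intro i j
    fin_cases i <;> fin_cases j <;> simp [h13, h14, h24]
  have hrec : ∀ i j, !![1, 1, a13, a14, 1; 1, 1, 1, a24, 1; 1 / a13, 1, 1, 1, 1; 1 / a14, 1 / a24, 1, 1, 1; 1, 1, 1, 1, 1] j i = 1 / !![1, 1, a13, a14, 1; 1, 1, 1, a24, 1; 1 / a13, 1, 1, 1, 1; 1 / a14, 1 / a24, 1, 1, 1; 1, 1, 1, 1, 1] i j := by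
    intro i j
    fin_cases i <;> fin_cases j <;> simp
  have key : ∀ u1 u2 u3 u4 : ℝ, 0 < u1 → 0 ≤ u2 → 0 ≤ u3 → 0 ≤ u4 → ∀ k l : Fin 5, l ≠ k →
      (∀ w : Fin 5 → ℝ,
        w 0 = u1 + u2 + a13 * u3 + a14 * u4 →
        w 1 = u1 + u2 + u3 + a24 * u4 →
        w 2 = u1 / a13 + u2 + u3 + u4 →
        w 3 = u1 / a14 + u2 / a24 + u3 + u4 →
        w 4 = u1 + u2 + u3 + u4 →
        ∀ j, j ≠ k → w k < !![1, 1, a13, a14, 1; 1, 1, 1, a24, 1; 1 / a13, 1, 1, 1, 1; 1 / a14, 1 / a24, 1, 1, 1; 1, 1, 1, 1, 1] k j * w j) → False := by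
    intro u1 u2 u3 u4 p1 p2 p3 p4 k l hl hw
    set A := !![1, 1, a13, a14, 1; 1, 1, 1, a24, 1; 1 / a13, 1, 1, 1, 1; 1 / a14, 1 / a24, 1, 1, 1; 1, 1, 1, 1, 1] with hA
    have e0 : A.mulVec ![u1, u2, u3, u4, 0] 0 = u1 + u2 + a13 * u3 + a14 * u4 := by
      simp [hA, Matrix.mulVec, dotProduct, Fin.sum_univ_succ]; ring
    have e1 : A.mulVec ![u1, u2, u3, u4, 0] 1 = u1 + u2 + u3 + a24 * u4 := by
      simp [hA, Matrix.mulVec, dotProduct, Fin.sum_univ_succ]; ring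
    have e2 : A.mulVec ![u1, u2, u3, u4, 0] 2 = u1 / a13 + u2 + u3 + u4 := by
      simp [hA, Matrix.mulVec, dotProduct, Fin.sum_univ_succ]; ring
    have e3 : A.mulVec ![u1, u2, u3, u4, 0] 3 = u1 / a14 + u2 / a24 + u3 + u4 := by
      simp [hA, Matrix.mulVec, dotProduct, Fin.sum_univ_succ]; ring
    have e4 : A.mulVec ![u1, u2, u3, u4, 0] 4 = u1 + u2 + u3 + u4 := by
      simp [hA, Matrix.mulVec, dotProduct, Fin.sum_univ_succ]; ring
    refine not_efficient_of_sink A hpos hrec _ k l hl (hw _ e0 e1 e2 e3 e4)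
      (hsub ⟨?_, ![u1, u2, u3, u4, 0], ?_, rfl⟩)
    · intro h0
      have := congrFun h0 4
      rw [e4] at this
      simp only [Pi.zero_apply] at this
      linarith
    · intro i
      fin_cases i <;> simp [p1.le, p2, p3, p4]
  rcases hcond with ⟨c1, c2, c3⟩ | ⟨c1, c2, c3⟩
  · have α : 0 < a13 - a14 := by linarith
    have β : 0 < a14 - a24 := by linarith
    have γ : 0 < a24 - 1 := by linarith
    obtain ⟨t, ht1, ht2⟩ := exists_between (show 1 < a13 by linarith)
    obtain ⟨s, hs1, hs2⟩ := exists_between (show t / a13 < 1 by rw [div_lt_one h13]; exact ht2)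
    have hs0 : 0 < s := lt_trans (by positivity) hs1
    rw [div_lt_iff₀ h13] at hs1
    have hu1 : 0 < a14 * (a24 - 1) * t := by positivity
    have hu2 : 0 < (a13 - a14) * a24 * s := by positivity
    refine key (a14 * (a24 - 1) * t) ((a13 - a14) * a24 * s) (a14 - a24) 0
      hu1 hu2.le β.le le_rfl 3 0 (by decide) ?_
    intro w w0 w1 w2 w3 w4 j hj
    fin_cases j
    · have : 1 / a14 * w 0 - w 3 = (a13 - a14) * (a14 - a24) / a14 * (1 - s) := by
        rw [w0, w3]; field_simp; ring
      have h : 0 < (a13 - a14) * (a14 - a24) / a14 * (1 - s) :=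
        mul_pos (by positivity) (by linarith)
      simp at this ⊢; linarith
    · have : 1 / a24 * w 1 - w 3 = (a24 - 1) * (a14 - a24) / a24 * (t - 1) := by
        rw [w1, w3]; field_simp; ring
      have h : 0 < (a24 - 1) * (a14 - a24) / a24 * (t - 1) :=
        mul_pos (by positivity) (by linarith)
      simp at this ⊢; linarith
    · have : w 2 - w 3 = (a24 - 1) * (a13 - a14) / a13 * (s * a13 - t) := by
        rw [w2, w3]; field_simp; ring
      have h : 0 < (a24 - 1) * (a13 - a14) / a13 * (s * a13 - t) :=
        mul_pos (by positivity) (by linarith)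
      simp at this ⊢; linarith
    · exact absurd rfl hj
    · have : w 4 - w 3 = (a24 - 1) * t * (a14 - 1) + (a13 - a14) * s * (a24 - 1) := by
        rw [w4, w3]; field_simp; ring
      have h : 0 < (a24 - 1) * t * (a14 - 1) := mul_pos (by positivity) (by linarith)
      have h' : 0 < (a13 - a14) * s * (a24 - 1) := by positivity
      simp at this ⊢; linarith
  · have α : 0 < a14 - a13 := by linarith
    have β : 0 < a13 - 1 := by linarith
    have γ : 0 < 1 - a24 := by linarith
    obtain ⟨t, ht1, ht2⟩ := exists_between (show 1 < a14 by linarith)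
    have hu1 : 0 < (1 - a24) * a13 * t := by positivity
    have hu2 : 0 < (a14 - a13) * a24 := by positivity
    refine key ((1 - a24) * a13 * t) ((a14 - a13) * a24) 0 (a13 - 1)
      hu1 hu2.le le_rfl β.le 2 0 (by decide) ?_
    intro w w0 w1 w2 w3 w4 j hj
    fin_cases j
    · have : 1 / a13 * w 0 - w 2 = (a14 - a13) * (a13 - 1) / a13 * (1 - a24) := by
        rw [w0, w2]; field_simp; ring
      have h : 0 < (a14 - a13) * (a13 - 1) / a13 * (1 - a24) := by positivity
      simp at this ⊢; linarith
    · have : w 1 - w 2 = (1 - a24) * (a13 - 1) * (t - 1) := by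
        rw [w1, w2]; field_simp; ring
      have h : 0 < (1 - a24) * (a13 - 1) * (t - 1) := mul_pos (by positivity) (by linarith)
      simp at this ⊢; linarith
    · exact absurd rfl hj
    · have : w 3 - w 2 = (1 - a24) * (a14 - a13) / a14 * (a14 - t) := by
        rw [w3, w2]; field_simp; ring
      have h : 0 < (1 - a24) * (a14 - a13) / a14 * (a14 - t) :=
        mul_pos (by positivity) (by linarith)
      simp at this ⊢; linarith
    · have : w 4 - w 2 = (1 - a24) * t * (a13 - 1) := by
        rw [w4, w2]; field_simp; ring
      have h : 0 < (1 - a24) * t * (a13 - 1) := by positivity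
      simp at this ⊢; linarith
end

section
/- Let n ≥ 5 and let R be an n×n reciprocal matrix. Suppose S is an n×n monomial matrix such that A = S R S⁻¹ is the n×n reciprocal matrix whose leading 4×4 principal submatrix has rows (1, 1, a_13, a_14), (1, 1, 1, a_24), (1/a_13, 1, 1, 1), (1/a_14, 1/a_24, 1, 1) and all of whose other entries equal 1, where a_13, a_24 > 0 and a_14 ≥ 1. Then C(R) ⊆ E(R) if and only if neither (1 < a_24 < a_14 < a_13) nor (a_24 < 1 < a_13 < a_14) holds. -/
open Matrix

/-- A cut set witnessing that the comparison digraph is not strongly connected. -/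
def HasCut {n : ℕ} (A : Matrix (Fin n) (Fin n) ℝ) (w : Fin n → ℝ) : Prop :=
  ∃ T : Set (Fin n), T.Nonempty ∧ Tᶜ.Nonempty ∧ ∀ i ∈ T, ∀ j ∉ T, w i < A i j * w j

theorem not_efficient_of_hasCut {n : ℕ} (A : Matrix (Fin n) (Fin n) ℝ) (hA : IsReciprocal A)
    (w : Fin n → ℝ) (hw : ∀ i, 0 < w i) (h : HasCut A w) : ¬ IsEfficient A w := by
  classical
  obtain ⟨T, ⟨i0, hi0⟩, ⟨j0, hj0⟩, hT⟩ := h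
  rintro ⟨-, heff⟩
  -- choose a scale factor
  have hc : ∃ c : ℝ, 1 < c ∧ ∀ i ∈ T, ∀ j ∉ T, c * w i ≤ A i j * w j := by
    have hev : ∀ᶠ c : ℝ in nhdsWithin 1 (Set.Ioi 1),
        ∀ i j, i ∈ T → j ∉ T → c * w i ≤ A i j * w j := by
      rw [Filter.eventually_all]
      intro i
      rw [Filter.eventually_all]
      intro j
      by_cases hi : i ∈ T
      · by_cases hj : j ∈ T
        · simp [hj]
        · have hlt : (1 : ℝ) * w i < A i j * w j := by simpa using hT i hi j hj
          have hcont : Continuous fun c : ℝ => c * w i := by fun_prop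
          have := (hcont.tendsto 1).eventually_lt_const hlt
          filter_upwards [nhdsWithin_le_nhds this] with c hc _ _ using hc.le
      · simp [hi]
    obtain ⟨c, h1, h2⟩ := (hev.and self_mem_nhdsWithin).exists
    exact ⟨c, h2, fun i hi j hj => h1 i j hi hj⟩
  obtain ⟨c, hc1, hc⟩ := hc
  have hc0 : 0 < c := by linarith
  obtain ⟨k, hk⟩ := heff (fun i => if i ∈ T then c * w i else w i)
    (fun i => by
      have := hw i
      split_ifs <;> positivity)
    (fun i j => by
      have hwi := hw i
      have hwj := hw j
      by_cases hi : i ∈ T <;> by_cases hj : j ∈ T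
      · rw [if_pos hi, if_pos hj, mul_div_mul_left _ _ hc0.ne']
      · rw [if_pos hi, if_neg hj]
        have h1 : c * w i / w j ≤ A i j := by
          rw [div_le_iff₀ hwj]; exact hc i hi j hj
        have h2 : w i / w j ≤ c * w i / w j := by
          gcongr
          nlinarith
        rw [abs_of_nonneg (by linarith), abs_of_nonneg (by linarith)]
        linarith
      · rw [if_neg hi, if_pos hj]
        have h1 : A i j ≤ w i / (c * w j) := by
          rw [le_div_iff₀ (by positivity)]
          have := hc j hj i hi
          have h3 := hA.2 j i
          have h4 := hA.1 j i
          rw [h3, one_div, inv_mul_le_iff₀ h4]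
          exact this
        have h2 : w i / (c * w j) ≤ w i / w j := by
          gcongr
          nlinarith
        rw [abs_of_nonpos (by linarith), abs_of_nonpos (by linarith)]
        linarith
      · rw [if_neg hi, if_neg hj])
  have e1 := congrFun hk i0
  have e2 := congrFun hk j0
  have hj0' : j0 ∉ T := hj0
  simp only [hi0, hj0', if_true, if_false, Pi.smul_apply, smul_eq_mul] at e1 e2
  have hwi := hw i0
  have hwj := hw j0
  have f1 : c = k := mul_right_cancel₀ hwi.ne' e1
  have f2 : (1 : ℝ) = k := mul_right_cancel₀ hwj.ne' (by linarith)
  linarith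

theorem efficient_of_not_hasCut {n : ℕ} (A : Matrix (Fin n) (Fin n) ℝ)
    (w : Fin n → ℝ) (hw : ∀ i, 0 < w i) (h : ¬ HasCut A w) : IsEfficient A w := by
  refine ⟨hw, fun v hv hle => ?_⟩
  rcases isEmpty_or_nonempty (Fin n) with he | hne
  · exact ⟨0, funext fun i => he.elim i⟩
  obtain ⟨i0, hi0⟩ := Finite.exists_max (fun i => v i / w i)
  refine ⟨v i0 / w i0, ?_⟩
  by_contra hne'
  apply h
  refine ⟨{i | v i / w i = v i0 / w i0}, ⟨i0, rfl⟩, ?_, ?_⟩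
  · by_contra hemp
    apply hne'
    funext i
    rw [Set.not_nonempty_iff_eq_empty, Set.compl_empty_iff] at hemp
    have : v i / w i = v i0 / w i0 := by
      have : i ∈ {i | v i / w i = v i0 / w i0} := by rw [hemp]; trivial
      exact this
    have hwi := hw i
    rw [Pi.smul_apply, smul_eq_mul, ← this]
    field_simp
  · intro i hi j hj
    have hi' : v i / w i = v i0 / w i0 := hi
    have hj' : v j / w j < v i / w i := by
      rw [hi']
      exact lt_of_le_of_ne (hi0 j) hj
    by_contra hcon
    push Not at hcon
    have hwi := hw i
    have hwj := hw j
    have hvi := hv i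
    have hvj := hv j
    have h1 : A i j ≤ w i / w j := by rwa [le_div_iff₀ hwj]
    have h2 := hle i j
    rw [abs_of_nonpos (sub_nonpos.2 h1)] at h2
    have h3 := (abs_le.1 h2).1
    have h4 : v i / v j ≤ w i / w j := by linarith
    rw [div_lt_div_iff₀ hwj hwi] at hj'
    rw [div_le_div_iff₀ hvj hwj] at h4
    linarith

theorem coneCols_subset_iff {n : ℕ} (A : Matrix (Fin n) (Fin n) ℝ) (hA : IsReciprocal A) :
    ConeCols A ⊆ EffSet A ↔
      ∀ u : Fin n → ℝ, (∀ i, 0 ≤ u i) → u ≠ 0 → ¬ HasCut A (A.mulVec u) := by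
  have hpos : ∀ u : Fin n → ℝ, (∀ i, 0 ≤ u i) → u ≠ 0 → ∀ i, 0 < A.mulVec u i := by
    intro u hu hne i
    obtain ⟨k, hk⟩ := Function.ne_iff.1 hne
    have hk' : 0 < u k := lt_of_le_of_ne (hu k) (Ne.symm hk)
    exact Finset.sum_pos' (fun j _ => mul_nonneg (hA.1 i j).le (hu j))
      ⟨k, Finset.mem_univ k, mul_pos (hA.1 i k) hk'⟩
  constructor
  · intro h u hu hne hcut
    have hp := hpos u hu hne
    refine not_efficient_of_hasCut A hA _ hp hcut (h ⟨?_, u, hu, rfl⟩)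
    obtain ⟨k, hk⟩ := Function.ne_iff.1 hne
    exact fun h0 => (hp k).ne' (congrFun h0 k)
  · rintro h w ⟨hw, u, hu, rfl⟩
    have hne : u ≠ 0 := by
      rintro rfl
      simp at hw
    exact efficient_of_not_hasCut A _ (hpos u hu hne) (h u hu hne)

theorem monomial_transfer {n : ℕ} (R S A : Matrix (Fin n) (Fin n) ℝ) (hS : IsMonomial S)
    (hSA : S * R * S⁻¹ = A) :
    (∀ u : Fin n → ℝ, (∀ i, 0 ≤ u i) → u ≠ 0 → ¬ HasCut R (R.mulVec u)) ↔
      ∀ u : Fin n → ℝ, (∀ i, 0 ≤ u i) → u ≠ 0 → ¬ HasCut A (A.mulVec u) := by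
  obtain ⟨σ, d, hd, rfl⟩ := hS
  have hunit : IsUnit (σ.permMatrix ℝ * Matrix.diagonal d).det := by
    rw [Matrix.det_mul, Matrix.det_permutation, Matrix.det_diagonal, isUnit_iff_ne_zero]
    refine mul_ne_zero ?_ (Finset.prod_ne_zero_iff.2 fun i _ => (hd i).ne')
    rcases Int.units_eq_one_or (Equiv.Perm.sign σ) with h | h <;> simp [h]
  have hmul : (σ.permMatrix ℝ * Matrix.diagonal d) * R
      = A * (σ.permMatrix ℝ * Matrix.diagonal d) := by
    rw [← hSA, Matrix.mul_assoc _ _ (σ.permMatrix ℝ * Matrix.diagonal d),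
      Matrix.nonsing_inv_mul _ hunit, Matrix.mul_one]
  have hent : ∀ i j, d (σ i) * R (σ i) (σ j) = A i j * d (σ j) := by
    intro i j
    have := congrFun (congrFun hmul i) (σ j)
    simp only [Matrix.mul_apply, Matrix.diagonal_apply, Equiv.Perm.permMatrix,
      PEquiv.toMatrix_apply, Equiv.toPEquiv_apply] at this
    simpa [Finset.sum_ite_eq, Finset.mul_sum, Finset.sum_mul, eq_comm, ite_and, Equiv.apply_eq_iff_eq] using this
  have hmv : ∀ u : Fin n → ℝ, ∀ i,
      A.mulVec (fun k => d (σ k) * u (σ k)) i = d (σ i) * R.mulVec u (σ i) := by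
    intro u i
    simp only [Matrix.mulVec, dotProduct]
    rw [← Equiv.sum_comp σ (fun k => R (σ i) k * u k), Finset.mul_sum]
    refine Finset.sum_congr rfl fun k _ => ?_
    rw [← mul_assoc, ← mul_assoc, hent]
  have hcut : ∀ u : Fin n → ℝ, HasCut A (A.mulVec (fun k => d (σ k) * u (σ k))) ↔
      HasCut R (R.mulVec u) := by
    intro u
    have key : ∀ i j, (A.mulVec (fun k => d (σ k) * u (σ k)) i
        < A i j * A.mulVec (fun k => d (σ k) * u (σ k)) j) ↔
        R.mulVec u (σ i) < R (σ i) (σ j) * R.mulVec u (σ j) := by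
      intro i j
      rw [hmv, hmv, ← mul_assoc, ← hent, mul_assoc]
      exact mul_lt_mul_iff_right₀ (hd _)
    constructor
    · rintro ⟨T, ⟨a, ha⟩, ⟨b, hb⟩, hT⟩
      refine ⟨{x | σ.symm x ∈ T}, ⟨σ a, by simpa using ha⟩, ⟨σ b, by simpa using hb⟩, ?_⟩
      intro i hi j hj
      have := (key _ _).1 (hT _ hi _ hj)
      simpa using this
    · rintro ⟨T, ⟨a, ha⟩, ⟨b, hb⟩, hT⟩
      refine ⟨{x | σ x ∈ T}, ⟨σ.symm a, by simpa using ha⟩, ⟨σ.symm b, by simpa using hb⟩, ?_⟩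
      intro i hi j hj
      exact (key _ _).2 (hT _ hi _ hj)
  constructor
  · intro h u hu hne hc
    have hfun : (fun k => d (σ k) * (fun x => u (σ.symm x) / d x) (σ k)) = u := by
      funext k
      have := (hd (σ k)).ne'
      simp
      field_simp
    refine h (fun x => u (σ.symm x) / d x) (fun x => div_nonneg (hu _) (hd x).le) ?_ ?_
    · rintro h0
      apply hne
      rw [← hfun, h0]
      funext k
      simp
    · rw [← hcut, hfun]
      exact hc
  · intro h u hu hne hc
    refine h (fun k => d (σ k) * u (σ k)) (fun k => mul_nonneg (hd _).le (hu _)) ?_ ((hcut u).2 hc)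
    intro h0
    apply hne
    funext x
    have := congrFun h0 (σ.symm x)
    simpa [(hd x).ne'] using this

theorem core_necessity (p q t : ℝ) (hp : 0 < p) (hq : 1 ≤ q) (ht : 0 < t)
    (u1 u2 u3 u4 r : ℝ) (h1 : 0 ≤ u1) (h2 : 0 ≤ u2) (h3 : 0 ≤ u3) (h4 : 0 ≤ u4) (hr : 0 ≤ r)
    (hb1 : ¬ (1 < t ∧ t < q ∧ q < p)) (hb2 : ¬ (t < 1 ∧ 1 < p ∧ p < q))
    (T1 T2 T3 T4 T5 : Prop)
    (d12 : T1 → ¬ T2 → (p-1)*u3+(q-t)*u4 < 0) (e12 : T2 → ¬ T1 → 0 < (p-1)*u3+(q-t)*u4)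
    (d23 : T2 → ¬ T3 → u1*(p-1)+p*(t-1)*u4 < 0) (e23 : T3 → ¬ T2 → 0 < u1*(p-1)+p*(t-1)*u4)
    (d34 : T3 → ¬ T4 → u1*t*(q-p)+p*q*u2*(t-1) < 0)
    (e34 : T4 → ¬ T3 → 0 < u1*t*(q-p)+p*q*u2*(t-1))
    (d15 : T1 → ¬ T5 → (p-1)*u3+(q-1)*u4 < 0) (e15 : T5 → ¬ T1 → 0 < (p-1)*u3+(q-1)*u4)
    (d25 : T2 → ¬ T5 → (t-1)*u4 < 0) (e25 : T5 → ¬ T2 → 0 < (t-1)*u4)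
    (d35 : T3 → ¬ T5 → (1-p)*u1 < 0) (e35 : T5 → ¬ T3 → 0 < (1-p)*u1)
    (d45 : T4 → ¬ T5 → t*(1-q)*u1+q*(1-t)*u2 < 0)
    (e45 : T5 → ¬ T4 → 0 < t*(1-q)*u1+q*(1-t)*u2)
    (d13 : T1 → ¬ T3 → (1-p)*(u2+r)+(q-p)*u4 < 0)
    (e13 : T3 → ¬ T1 → 0 < (1-p)*(u2+r)+(q-p)*u4)
    (d14 : T1 → ¬ T4 → t*(1-q)*r+u2*(t-q)+t*u3*(p-q) < 0)
    (e14 : T4 → ¬ T1 → 0 < t*(1-q)*r+u2*(t-q)+t*u3*(p-q))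
    (d24 : T2 → ¬ T4 → u1*(q-t)+q*(u3+r)*(1-t) < 0)
    (e24 : T4 → ¬ T2 → 0 < u1*(q-t)+q*(u3+r)*(1-t)) :
    (T1 ∧ T2 ∧ T3 ∧ T4 ∧ T5) ∨ (¬ T1 ∧ ¬ T2 ∧ ¬ T3 ∧ ¬ T4 ∧ ¬ T5) := by
  have hq0 : 0 < q := by linarith
  -- sign extraction helpers
  have neg_of : ∀ a b : ℝ, 0 ≤ b → a * b < 0 → a < 0 := fun a b hb h => by
    by_contra hc
    exact absurd (mul_nonneg (not_lt.1 hc) hb) (not_le.2 h)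
  have pos_of : ∀ a b : ℝ, 0 ≤ b → 0 < a * b → 0 < a := fun a b hb h => by
    by_contra hc
    exact absurd (mul_nonpos_of_nonpos_of_nonneg (not_lt.1 hc) hb) (not_le.2 h)
  have s2 : T2 → ¬ T5 → t < 1 := fun a b => by linarith [neg_of _ _ h4 (d25 a b)]
  have s2' : T5 → ¬ T2 → 1 < t := fun a b => by linarith [pos_of _ _ h4 (e25 a b)]
  have s3 : T3 → ¬ T5 → 1 < p := fun a b => by linarith [neg_of _ _ h1 (d35 a b)]
  have s3' : T5 → ¬ T3 → p < 1 := fun a b => by linarith [pos_of _ _ h1 (e35 a b)]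
  have s1 : T1 → ¬ T5 → p < 1 := fun a b => by
    have := d15 a b
    have h := mul_nonneg (sub_nonneg.2 hq) h4
    linarith [neg_of (p-1) u3 h3 (by linarith)]
  have s4' : T5 → ¬ T4 → t < 1 := fun a b => by
    have := e45 a b
    have h := mul_nonneg (mul_nonneg ht.le (sub_nonneg.2 hq)) h1
    have := pos_of (q*(1-t)) u2 h2 (by linarith)
    have := pos_of (1-t) q hq0.le (by linarith)
    linarith
  -- edge sign facts
  have n13 : p ≤ 1 → 0 ≤ (1-p)*(u2+r)+(q-p)*u4 := fun h => by
    have a := mul_nonneg (sub_nonneg.2 h) (add_nonneg h2 hr)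
    have b := mul_nonneg (by linarith : 0 ≤ q - p) h4
    linarith
  have m13 : q ≤ p → (1-p)*(u2+r)+(q-p)*u4 ≤ 0 := fun h => by
    have a := mul_nonneg (by linarith : 0 ≤ p - 1) (add_nonneg h2 hr)
    have b := mul_nonneg (by linarith : 0 ≤ p - q) h4
    linarith
  have n24 : t ≤ 1 → 0 ≤ u1*(q-t)+q*(u3+r)*(1-t) := fun h => by
    have a := mul_nonneg h1 (by linarith : 0 ≤ q - t)
    have b := mul_nonneg (mul_nonneg hq0.le (add_nonneg h3 hr)) (by linarith : 0 ≤ 1 - t)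
    linarith
  have m24 : q ≤ t → u1*(q-t)+q*(u3+r)*(1-t) ≤ 0 := fun h => by
    have a := mul_nonneg h1 (by linarith : 0 ≤ t - q)
    have b := mul_nonneg (mul_nonneg hq0.le (add_nonneg h3 hr)) (by linarith : 0 ≤ t - 1)
    linarith
  have m14 : t ≤ q → p ≤ q → t*(1-q)*r+u2*(t-q)+t*u3*(p-q) ≤ 0 := fun h h' => by
    have a := mul_nonneg (mul_nonneg ht.le (by linarith : 0 ≤ q - 1)) hr
    have b := mul_nonneg h2 (by linarith : 0 ≤ q - t)
    have c := mul_nonneg (mul_nonneg ht.le h3) (by linarith : 0 ≤ q - p)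
    linarith
  have m34 : q ≤ p → t ≤ 1 → u1*t*(q-p)+p*q*u2*(t-1) ≤ 0 := fun h h' => by
    have a := mul_nonneg (mul_nonneg h1 ht.le) (by linarith : 0 ≤ p - q)
    have b := mul_nonneg (mul_nonneg (mul_nonneg hp.le hq0.le) h2) (by linarith : 0 ≤ 1 - t)
    linarith
  have n34 : p ≤ q → 1 ≤ t → 0 ≤ u1*t*(q-p)+p*q*u2*(t-1) := fun h h' => by
    have a := mul_nonneg (mul_nonneg h1 ht.le) (by linarith : 0 ≤ q - p)
    have b := mul_nonneg (mul_nonneg (mul_nonneg hp.le hq0.le) h2) (by linarith : 0 ≤ t - 1)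
    linarith
  have m12 : p ≤ 1 → q ≤ t → (p-1)*u3+(q-t)*u4 ≤ 0 := fun h h' => by
    have a := mul_nonneg (by linarith : 0 ≤ 1 - p) h3
    have b := mul_nonneg (by linarith : 0 ≤ t - q) h4
    linarith
  have f13 : T1 → ¬ T3 → 1 < p := fun a b => by
    by_contra hc
    linarith [d13 a b, n13 (not_lt.1 hc)]
  have g13 : T3 → ¬ T1 → p < q := fun a b => by
    by_contra hc
    linarith [e13 a b, m13 (not_lt.1 hc)]
  have f24 : T2 → ¬ T4 → 1 < t := fun a b => by
    by_contra hc
    linarith [d24 a b, n24 (not_lt.1 hc)]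
  have g24 : T4 → ¬ T2 → t < q := fun a b => by
    by_contra hc
    linarith [e24 a b, m24 (not_lt.1 hc)]
  have g14 : T4 → ¬ T1 → q < t ∨ q < p := fun a b => by
    by_contra hc
    rw [not_or, not_lt, not_lt] at hc
    linarith [e14 a b, m14 hc.1 hc.2]
  have f34 : T3 → ¬ T4 → q < p ∨ t < 1 := fun a b => by
    by_contra hc
    rw [not_or, not_lt, not_lt] at hc
    linarith [d34 a b, n34 hc.1 hc.2]
  have g34 : T4 → ¬ T3 → p < q ∨ 1 < t := fun a b => by
    by_contra hc
    rw [not_or, not_lt, not_lt] at hc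
    linarith [e34 a b, m34 hc.1 hc.2]
  have g12 : T2 → ¬ T1 → 1 < p ∨ t < q := fun a b => by
    by_contra hc
    rw [not_or, not_lt, not_lt] at hc
    linarith [e12 a b, m12 hc.1 hc.2]
  have f12 : T1 → ¬ T2 → p < 1 ∨ q < t := fun a b => by
    by_contra hc
    rw [not_or, not_lt, not_lt] at hc
    have x := mul_nonneg (sub_nonneg.2 hc.1) h3
    have y := mul_nonneg (sub_nonneg.2 hc.2) h4
    linarith [d12 a b]
  have sp2 : T1 → ¬ T2 → T3 → T4 → T5 → False := fun a1 a2 a3 a4 a5 => by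
    have ht1 := s2' a5 a2
    have htq := g24 a4 a2
    have hp1 : p < 1 := by rcases f12 a1 a2 with h | h <;> linarith
    have x12 := d12 a1 a2
    have x23 := e23 a3 a2
    have x24 := e24 a4 a2
    have y12 := mul_pos (mul_pos (mul_pos hp hq0) (sub_pos.2 ht1)) (neg_pos.2 x12)
    have y23 := mul_pos (mul_pos hq0 (sub_pos.2 htq)) x23
    have y24 := mul_pos (mul_pos hp (sub_pos.2 hp1)) x24
    have z1 := mul_nonneg (mul_nonneg (mul_nonneg h1 (sub_pos.2 hp1).le) (sub_pos.2 htq).le)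
      (by linarith : 0 ≤ q - p)
    have z2 := mul_nonneg (mul_nonneg (mul_nonneg (mul_nonneg hp.le (sub_pos.2 hp1).le) hq0.le) hr)
      (sub_pos.2 ht1).le
    linarith
  have sp1 : ¬ T1 → T2 → T3 → T4 → T5 → False := fun a1 a2 a3 a4 a5 => by
    have hpq := g13 a3 a1
    have hqt : q < t := by rcases g14 a4 a1 with h | h <;> linarith
    have hp1 : 1 < p := by rcases g12 a2 a1 with h | h <;> linarith
    have x12 := e12 a2 a1
    have x13 := e13 a3 a1
    have x14 := e14 a4 a1
    have y12 := mul_pos (mul_pos ht (sub_pos.2 hpq)) x12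
    have y13 := mul_pos (sub_pos.2 hqt) x13
    have y14 := mul_pos (sub_pos.2 hp1) x14
    have z1 := mul_nonneg (mul_nonneg (mul_nonneg (sub_pos.2 hpq).le (sub_pos.2 hqt).le) h4)
      (by linarith : 0 ≤ t - 1)
    have z2 := mul_nonneg (mul_nonneg (mul_nonneg ht.le (sub_nonneg.2 hq)) hr) (sub_pos.2 hp1).le
    have z3 := mul_nonneg (mul_nonneg (sub_pos.2 hqt).le (sub_pos.2 hp1).le) hr
    linarith
  clear d12 e12 d23 e23 d34 e34 d15 e15 d25 e25 d35 e35 d45 e45 d13 e13 d14 e14 d24 e24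
  clear n13 m13 n24 m24 m14 m34 n34 m12 neg_of pos_of h1 h2 h3 h4 hr
  by_cases a1 : T1 <;> by_cases a2 : T2 <;> by_cases a3 : T3 <;> by_cases a4 : T4 <;>
    by_cases a5 : T5 <;> simp only [a1, a2, a3, a4, a5, not_true, not_false_iff, true_and,
      and_true, and_false, or_false, false_or, forall_const,
      imp_false, IsEmpty.forall_iff] at * <;> grind

/-- The normal form of the matrix. -/
noncomputable def Tri (m : ℕ) (p q t : ℝ) : Matrix (Fin (m + 5)) (Fin (m + 5)) ℝ := Matrix.of fun i j =>
  if h : (i : ℕ) < 4 ∧ (j : ℕ) < 4 then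
    !![1, 1, p, q; 1, 1, 1, t; 1 / p, 1, 1, 1; 1 / q, 1 / t, 1, 1] ⟨i, h.1⟩ ⟨j, h.2⟩
  else 1

theorem tri_big_left (m : ℕ) (p q t : ℝ) (i j : Fin (m + 5)) (h : 4 ≤ (i : ℕ)) :
    Tri m p q t i j = 1 := by
  simp [Tri, h]

theorem tri_big_right (m : ℕ) (p q t : ℝ) (i j : Fin (m + 5)) (h : 4 ≤ (j : ℕ)) :
    Tri m p q t i j = 1 := by
  simp [Tri, h]

theorem tri_small (m : ℕ) (p q t : ℝ) (i j : Fin (m + 5)) (a b : Fin 4)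
    (hi : (i : ℕ) = a) (hj : (j : ℕ) = b) :
    Tri m p q t i j =
      !![1, 1, p, q; 1, 1, 1, t; 1 / p, 1, 1, 1; 1 / q, 1 / t, 1, 1] a b := by
  have h : (i : ℕ) < 4 ∧ (j : ℕ) < 4 := by omega
  have ha : (⟨i, h.1⟩ : Fin 4) = a := Fin.ext hi
  have hb : (⟨j, h.2⟩ : Fin 4) = b := Fin.ext hj
  rw [Tri, Matrix.of_apply, dif_pos h, ha, hb]

theorem tri_entries (m : ℕ) (p q t : ℝ) :
    (Tri m p q t 0 0 = 1 ∧ Tri m p q t 0 1 = 1 ∧ Tri m p q t 0 2 = p ∧ Tri m p q t 0 3 = q) ∧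
    (Tri m p q t 1 0 = 1 ∧ Tri m p q t 1 1 = 1 ∧ Tri m p q t 1 2 = 1 ∧ Tri m p q t 1 3 = t) ∧
    (Tri m p q t 2 0 = 1 / p ∧ Tri m p q t 2 1 = 1 ∧ Tri m p q t 2 2 = 1 ∧
      Tri m p q t 2 3 = 1) ∧
    (Tri m p q t 3 0 = 1 / q ∧ Tri m p q t 3 1 = 1 / t ∧ Tri m p q t 3 2 = 1 ∧
      Tri m p q t 3 3 = 1) := by
  have v0 : ((0 : Fin (m + 5)) : ℕ) = (0 : Fin 4) := rfl
  have v1 : ((1 : Fin (m + 5)) : ℕ) = (1 : Fin 4) := rfl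
  have v2 : ((2 : Fin (m + 5)) : ℕ) = (2 : Fin 4) := rfl
  have v3 : ((3 : Fin (m + 5)) : ℕ) = (3 : Fin 4) := rfl
  refine ⟨⟨?_, ?_, ?_, ?_⟩, ⟨?_, ?_, ?_, ?_⟩, ⟨?_, ?_, ?_, ?_⟩, ⟨?_, ?_, ?_, ?_⟩⟩
  · rw [tri_small m p q t _ _ _ _ v0 v0]; rfl
  · rw [tri_small m p q t _ _ _ _ v0 v1]; rfl
  · rw [tri_small m p q t _ _ _ _ v0 v2]; rfl
  · rw [tri_small m p q t _ _ _ _ v0 v3]; rfl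
  · rw [tri_small m p q t _ _ _ _ v1 v0]; rfl
  · rw [tri_small m p q t _ _ _ _ v1 v1]; rfl
  · rw [tri_small m p q t _ _ _ _ v1 v2]; rfl
  · rw [tri_small m p q t _ _ _ _ v1 v3]; rfl
  · rw [tri_small m p q t _ _ _ _ v2 v0]; rfl
  · rw [tri_small m p q t _ _ _ _ v2 v1]; rfl
  · rw [tri_small m p q t _ _ _ _ v2 v2]; rfl
  · rw [tri_small m p q t _ _ _ _ v2 v3]; rfl
  · rw [tri_small m p q t _ _ _ _ v3 v0]; rfl
  · rw [tri_small m p q t _ _ _ _ v3 v1]; rfl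
  · rw [tri_small m p q t _ _ _ _ v3 v2]; rfl
  · rw [tri_small m p q t _ _ _ _ v3 v3]; rfl

theorem sum_split {m : ℕ} (f : Fin (m + 5) → ℝ) :
    ∑ i, f i = f 0 + f 1 + f 2 + f 3 + ∑ k : Fin (m + 1), f k.succ.succ.succ.succ := by
  rw [Fin.sum_univ_succ, Fin.sum_univ_succ, Fin.sum_univ_succ, Fin.sum_univ_succ]
  have e1 : (Fin.succ 0 : Fin (m + 5)) = 1 := rfl
  have e2 : (Fin.succ (Fin.succ 0) : Fin (m + 5)) = 2 := rfl
  have e3 : (Fin.succ (Fin.succ (Fin.succ 0)) : Fin (m + 5)) = 3 := rfl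
  rw [e1, e2, e3]
  ring

theorem tri_mulVec {m : ℕ} (p q t : ℝ) (u : Fin (m + 5) → ℝ) (r : ℝ)
    (hr : r = ∑ k : Fin (m + 1), u k.succ.succ.succ.succ) :
    (Tri m p q t).mulVec u 0 = u 0 + u 1 + p * u 2 + q * u 3 + r ∧
    (Tri m p q t).mulVec u 1 = u 0 + u 1 + u 2 + t * u 3 + r ∧
    (Tri m p q t).mulVec u 2 = 1 / p * u 0 + u 1 + u 2 + u 3 + r ∧
    (Tri m p q t).mulVec u 3 = 1 / q * u 0 + 1 / t * u 1 + u 2 + u 3 + r ∧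
    ∀ i : Fin (m + 5), 4 ≤ (i : ℕ) → (Tri m p q t).mulVec u i = u 0 + u 1 + u 2 + u 3 + r := by
  have hs : ∀ i : Fin (m + 5), (Tri m p q t).mulVec u i =
      Tri m p q t i 0 * u 0 + Tri m p q t i 1 * u 1 + Tri m p q t i 2 * u 2 +
      Tri m p q t i 3 * u 3 + r := by
    intro i
    rw [hr, Matrix.mulVec, dotProduct, sum_split]
    congr 1
    refine Finset.sum_congr rfl fun k _ => ?_
    rw [tri_big_right _ _ _ _ _ _ (by simp), one_mul]
  obtain ⟨⟨e00, e01, e02, e03⟩, ⟨e10, e11, e12, e13⟩, ⟨e20, e21, e22, e23⟩, e30, e31, e32, e33⟩ :=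
    tri_entries m p q t
  refine ⟨?_, ?_, ?_, ?_, ?_⟩
  · rw [hs, e00, e01, e02, e03]; ring
  · rw [hs, e10, e11, e12, e13]; ring
  · rw [hs, e20, e21, e22, e23]; ring
  · rw [hs, e30, e31, e32, e33]; ring
  · intro i hi
    rw [hs]
    simp only [tri_big_left _ _ _ _ _ _ hi, one_mul]

theorem edge_iff (a c x y E : ℝ) (ha : 0 < a) (hc : 0 < c) (hE : E = c * (x - a * y)) :
    (x < a * y ↔ E < 0) ∧ (y < 1 / a * x ↔ 0 < E) := by
  subst hE
  constructor
  · constructor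
    · intro h
      exact mul_neg_of_pos_of_neg hc (sub_neg.2 h)
    · intro h
      exact sub_neg.1 ((mul_neg_iff.1 h).resolve_right (fun h' => absurd hc h'.1.not_gt) |>.2)
  · rw [mul_pos_iff_of_pos_left hc, sub_pos, one_div, lt_inv_mul_iff₀ ha]

theorem edge_iff_one (c x y E : ℝ) (hc : 0 < c) (hE : E = c * (x - y)) :
    (x < 1 * y ↔ E < 0) ∧ (y < 1 * x ↔ 0 < E) := by
  have := edge_iff 1 c x y E one_pos hc (by rw [hE, one_mul])
  simpa using this

theorem tri_edges {m : ℕ} (p q t : ℝ) (hp : 0 < p) (hq : 0 < q) (ht : 0 < t)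
    (u : Fin (m + 5) → ℝ) (w : Fin (m + 5) → ℝ) (hw : w = (Tri m p q t).mulVec u) (r : ℝ)
    (hr : r = ∑ k : Fin (m + 1), u k.succ.succ.succ.succ) (k : Fin (m + 5)) (hk : 4 ≤ (k : ℕ)) :
    ((w 0 < Tri m p q t 0 1 * w 1 ↔ (p-1)*u 2+(q-t)*u 3 < 0) ∧
      (w 1 < Tri m p q t 1 0 * w 0 ↔ 0 < (p-1)*u 2+(q-t)*u 3)) ∧
    ((w 1 < Tri m p q t 1 2 * w 2 ↔ u 0*(p-1)+p*(t-1)*u 3 < 0) ∧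
      (w 2 < Tri m p q t 2 1 * w 1 ↔ 0 < u 0*(p-1)+p*(t-1)*u 3)) ∧
    ((w 2 < Tri m p q t 2 3 * w 3 ↔ u 0*t*(q-p)+p*q*u 1*(t-1) < 0) ∧
      (w 3 < Tri m p q t 3 2 * w 2 ↔ 0 < u 0*t*(q-p)+p*q*u 1*(t-1))) ∧
    ((w 0 < Tri m p q t 0 k * w k ↔ (p-1)*u 2+(q-1)*u 3 < 0) ∧
      (w k < Tri m p q t k 0 * w 0 ↔ 0 < (p-1)*u 2+(q-1)*u 3)) ∧
    ((w 1 < Tri m p q t 1 k * w k ↔ (t-1)*u 3 < 0) ∧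
      (w k < Tri m p q t k 1 * w 1 ↔ 0 < (t-1)*u 3)) ∧
    ((w 2 < Tri m p q t 2 k * w k ↔ (1-p)*u 0 < 0) ∧
      (w k < Tri m p q t k 2 * w 2 ↔ 0 < (1-p)*u 0)) ∧
    ((w 3 < Tri m p q t 3 k * w k ↔ t*(1-q)*u 0+q*(1-t)*u 1 < 0) ∧
      (w k < Tri m p q t k 3 * w 3 ↔ 0 < t*(1-q)*u 0+q*(1-t)*u 1)) ∧
    ((w 0 < Tri m p q t 0 2 * w 2 ↔ (1-p)*(u 1+r)+(q-p)*u 3 < 0) ∧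
      (w 2 < Tri m p q t 2 0 * w 0 ↔ 0 < (1-p)*(u 1+r)+(q-p)*u 3)) ∧
    ((w 0 < Tri m p q t 0 3 * w 3 ↔ t*(1-q)*r+u 1*(t-q)+t*u 2*(p-q) < 0) ∧
      (w 3 < Tri m p q t 3 0 * w 0 ↔ 0 < t*(1-q)*r+u 1*(t-q)+t*u 2*(p-q))) ∧
    ((w 1 < Tri m p q t 1 3 * w 3 ↔ u 0*(q-t)+q*(u 2+r)*(1-t) < 0) ∧
      (w 3 < Tri m p q t 3 1 * w 1 ↔ 0 < u 0*(q-t)+q*(u 2+r)*(1-t))) := by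
  obtain ⟨⟨e00, e01, e02, e03⟩, ⟨e10, e11, e12, e13⟩, ⟨e20, e21, e22, e23⟩, e30, e31, e32, e33⟩ :=
    tri_entries m p q t
  obtain ⟨w0, w1, w2, w3, w4⟩ := tri_mulVec p q t u r hr
  have wk := w4 k hk
  rw [← hw] at w0 w1 w2 w3 wk
  refine ⟨?_, ?_, ?_, ?_, ?_, ?_, ?_, ?_, ?_, ?_⟩
  · rw [e01, e10]
    exact edge_iff_one 1 _ _ _ one_pos (by rw [w0, w1]; ring)
  · rw [e12, e21]
    exact edge_iff_one p _ _ _ hp (by rw [w1, w2]; field_simp; ring)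
  · rw [e23, e32]
    exact edge_iff_one (p * q * t) _ _ _ (by positivity) (by rw [w2, w3]; field_simp; ring)
  · rw [tri_big_left _ _ _ _ _ _ hk, tri_big_right _ _ _ _ _ _ hk]
    exact edge_iff_one 1 _ _ _ one_pos (by rw [w0, wk]; ring)
  · rw [tri_big_left _ _ _ _ _ _ hk, tri_big_right _ _ _ _ _ _ hk]
    exact edge_iff_one 1 _ _ _ one_pos (by rw [w1, wk]; ring)
  · rw [tri_big_left _ _ _ _ _ _ hk, tri_big_right _ _ _ _ _ _ hk]
    exact edge_iff_one p _ _ _ hp (by rw [w2, wk]; field_simp; ring)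
  · rw [tri_big_left _ _ _ _ _ _ hk, tri_big_right _ _ _ _ _ _ hk]
    exact edge_iff_one (q * t) _ _ _ (by positivity) (by rw [w3, wk]; field_simp; ring)
  · rw [e02, e20]
    exact edge_iff p 1 _ _ _ hp one_pos (by rw [w0, w2]; field_simp; ring)
  · rw [e03, e30]
    exact edge_iff q t _ _ _ hq ht (by rw [w0, w3]; field_simp; ring)
  · rw [e13, e31]
    exact edge_iff t q _ _ _ ht hq (by rw [w1, w3]; field_simp; ring)

theorem fin_cases5 {m : ℕ} (j : Fin (m + 5)) : j = 0 ∨ j = 1 ∨ j = 2 ∨ j = 3 ∨ 4 ≤ (j : ℕ) := by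
  have v0 : ((0 : Fin (m + 5)) : ℕ) = 0 := rfl
  have v1 : ((1 : Fin (m + 5)) : ℕ) = 1 := rfl
  have v2 : ((2 : Fin (m + 5)) : ℕ) = 2 := rfl
  have v3 : ((3 : Fin (m + 5)) : ℕ) = 3 := rfl
  simp only [Fin.ext_iff, v0, v1, v2, v3]
  omega

/-- A vector supported on the first four coordinates. -/
def vec4 (m : ℕ) (x0 x1 x2 x3 : ℝ) : Fin (m + 5) → ℝ := fun i =>
  if (i : ℕ) = 0 then x0 else if (i : ℕ) = 1 then x1 else if (i : ℕ) = 2 then x2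
  else if (i : ℕ) = 3 then x3 else 0

theorem vec4_vals (m : ℕ) (x0 x1 x2 x3 : ℝ) :
    vec4 m x0 x1 x2 x3 0 = x0 ∧ vec4 m x0 x1 x2 x3 1 = x1 ∧ vec4 m x0 x1 x2 x3 2 = x2 ∧
    vec4 m x0 x1 x2 x3 3 = x3 ∧
    (0 : ℝ) = ∑ k : Fin (m + 1), vec4 m x0 x1 x2 x3 k.succ.succ.succ.succ := by
  have v0 : ((0 : Fin (m + 5)) : ℕ) = 0 := rfl
  have v1 : ((1 : Fin (m + 5)) : ℕ) = 1 := rfl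
  have v2 : ((2 : Fin (m + 5)) : ℕ) = 2 := rfl
  have v3 : ((3 : Fin (m + 5)) : ℕ) = 3 := rfl
  refine ⟨by simp [vec4], by simp [vec4], by simp only [vec4, v2]; norm_num,
    by simp only [vec4, v3]; norm_num, ?_⟩
  symm
  refine Finset.sum_eq_zero fun k _ => ?_
  simp [vec4]

theorem vec4_nonneg (m : ℕ) (x0 x1 x2 x3 : ℝ) (h0 : 0 ≤ x0) (h1 : 0 ≤ x1) (h2 : 0 ≤ x2)
    (h3 : 0 ≤ x3) (i : Fin (m + 5)) : 0 ≤ vec4 m x0 x1 x2 x3 i := by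
  unfold vec4
  split_ifs <;> first | assumption | exact le_rfl

theorem vec4_ne (m : ℕ) (x0 x1 x2 x3 : ℝ) (h0 : 0 < x0) : vec4 m x0 x1 x2 x3 ≠ 0 := by
  intro h
  have := congrFun h 0
  rw [(vec4_vals m x0 x1 x2 x3).1] at this
  exact h0.ne' this

theorem cut_case1 (m : ℕ) (p q t : ℝ) (h1 : 1 < t) (h2 : t < q) (h3 : q < p) :
    ∃ u : Fin (m + 5) → ℝ, (∀ i, 0 ≤ u i) ∧ u ≠ 0 ∧
      HasCut (Tri m p q t) ((Tri m p q t).mulVec u) := by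
  have ht : 0 < t := by linarith
  have hq : 0 < q := by linarith
  have hp : 0 < p := by linarith
  have t1 : 0 < t - 1 := by linarith
  have qt : 0 < q - t := by linarith
  have pq : 0 < p - q := by linarith
  have p1 : 0 < p - 1 := by linarith
  have q1 : 0 < q - 1 := by linarith
  have x0 : 0 < q * (t - 1) * (3 * p) := by positivity
  have x1 : 0 < t * (p - q) * (p + 2) := by positivity
  have x2 : 0 < (q - t) * (2 * p + 1) := by positivity
  refine ⟨vec4 m (q * (t - 1) * (3 * p)) (t * (p - q) * (p + 2)) ((q - t) * (2 * p + 1)) 0,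
    vec4_nonneg _ _ _ _ _ x0.le x1.le x2.le le_rfl, vec4_ne _ _ _ _ _ x0, {3},
    Set.singleton_nonempty _, ⟨0, fun h => absurd (congrArg Fin.val (Set.mem_singleton_iff.1 h)) (Nat.succ_ne_zero _).symm⟩, ?_⟩
  obtain ⟨u0, u1, u2, u3, ur⟩ := vec4_vals m (q * (t - 1) * (3 * p)) (t * (p - q) * (p + 2))
    ((q - t) * (2 * p + 1)) 0
  have big : 4 ≤ ((⟨4, by omega⟩ : Fin (m + 5)) : ℕ) := le_rfl
  have ed := fun k hk => tri_edges p q t hp hq ht _ _ rfl 0 ur k hk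
  obtain ⟨-, -, ⟨-, e34⟩, -, -, -, -, -, ⟨-, e14⟩, ⟨-, e24⟩⟩ := ed _ big
  rw [u0, u1] at e34
  rw [u1, u2] at e14
  rw [u0, u2] at e24
  intro i hi j hj
  rw [Set.mem_singleton_iff] at hi hj
  subst hi
  rcases fin_cases5 j with rfl | rfl | rfl | rfl | hk
  · rw [e14]
    have : 0 < t * (p - q) * (q - t) * (p - 1) := by positivity
    linarith
  · rw [e24]
    have : 0 < q * (t - 1) * (q - t) * (p - 1) := by positivity
    linarith
  · rw [e34]
    have : 0 < p * q * t * (t - 1) * (p - q) * (p - 1) := by positivity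
    linarith
  · exact absurd rfl hj
  · obtain ⟨-, -, -, -, -, -, ⟨e45, -⟩, -⟩ := ed j hk
    rw [e45, u0, u1]
    have a := mul_pos (mul_pos ht q1) x0
    have b := mul_pos (mul_pos hq t1) x1
    linarith

theorem cut_case2 (m : ℕ) (p q t : ℝ) (ht : 0 < t) (h1 : t < 1) (h2 : 1 < p) (h3 : p < q) :
    ∃ u : Fin (m + 5) → ℝ, (∀ i, 0 ≤ u i) ∧ u ≠ 0 ∧
      HasCut (Tri m p q t) ((Tri m p q t).mulVec u) := by
  have hq : 0 < q := by linarith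
  have hp : 0 < p := by linarith
  have t1 : 0 < 1 - t := by linarith
  have qt : 0 < q - t := by linarith
  have qp : 0 < q - p := by linarith
  have p1 : 0 < p - 1 := by linarith
  have x0 : 0 < 3 * p * q * (1 - t) := by positivity
  have x1 : 0 < (q - p) * (q + 2 * t) := by positivity
  have x3 : 0 < (p - 1) * (2 * q + t) := by positivity
  refine ⟨vec4 m (3 * p * q * (1 - t)) ((q - p) * (q + 2 * t)) 0 ((p - 1) * (2 * q + t)),
    vec4_nonneg _ _ _ _ _ x0.le x1.le le_rfl x3.le, vec4_ne _ _ _ _ _ x0, {2},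
    Set.singleton_nonempty _, ⟨0, fun h => absurd (congrArg Fin.val (Set.mem_singleton_iff.1 h)) (Nat.succ_ne_zero _).symm⟩, ?_⟩
  obtain ⟨u0, u1, u2, u3, ur⟩ := vec4_vals m (3 * p * q * (1 - t)) ((q - p) * (q + 2 * t)) 0
    ((p - 1) * (2 * q + t))
  have big : 4 ≤ ((⟨4, by omega⟩ : Fin (m + 5)) : ℕ) := le_rfl
  have ed := fun k hk => tri_edges p q t hp hq ht _ _ rfl 0 ur k hk
  obtain ⟨-, ⟨-, e23⟩, ⟨e34, -⟩, -, -, -, -, ⟨-, e13⟩, -⟩ := ed _ big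
  rw [u0, u3] at e23
  rw [u0, u1] at e34
  rw [u1, u3] at e13
  intro i hi j hj
  rw [Set.mem_singleton_iff] at hi hj
  subst hi
  rcases fin_cases5 j with rfl | rfl | rfl | rfl | hk
  · rw [e13]
    have : 0 < (q - p) * (p - 1) * (q - t) := by positivity
    linarith
  · rw [e23]
    have : 0 < p * (1 - t) * (p - 1) * (q - t) := by positivity
    linarith
  · exact absurd rfl hj
  · rw [e34]
    have : 0 < p * q * (1 - t) * (q - p) * (q - t) := by positivity
    linarith
  · obtain ⟨-, -, -, -, -, ⟨e35, -⟩, -⟩ := ed j hk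
    rw [e35, u0]
    have a := mul_pos p1 x0
    linarith

theorem tri_no_cut (m : ℕ) (p q t : ℝ) (hp : 0 < p) (hq : 1 ≤ q) (ht : 0 < t)
    (hb1 : ¬ (1 < t ∧ t < q ∧ q < p)) (hb2 : ¬ (t < 1 ∧ 1 < p ∧ p < q))
    (u : Fin (m + 5) → ℝ) (hu : ∀ i, 0 ≤ u i) :
    ¬ HasCut (Tri m p q t) ((Tri m p q t).mulVec u) := by
  rintro ⟨T, ⟨a, ha⟩, ⟨b, hb⟩, hT⟩
  have hq0 : 0 < q := by linarith
  have hb' : b ∉ T := hb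
  set f : Fin (m + 5) := ⟨4, by omega⟩ with hf
  have big : 4 ≤ (f : ℕ) := le_rfl
  obtain ⟨⟨d12, e12⟩, ⟨d23, e23⟩, ⟨d34, e34⟩, ⟨d15, e15⟩, ⟨d25, e25⟩, ⟨d35, e35⟩, ⟨d45, e45⟩,
    ⟨d13, e13⟩, ⟨d14, e14⟩, ⟨d24, e24⟩⟩ := tri_edges p q t hp hq0 ht u _ rfl _ rfl f big
  have htail : ∀ k : Fin (m + 5), 4 ≤ (k : ℕ) → (k ∈ T ↔ f ∈ T) := by
    obtain ⟨-, -, -, -, w4⟩ := tri_mulVec p q t u _ rfl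
    intro k hk
    by_contra hcon
    rcases not_iff.1 hcon with h
    by_cases hfT : f ∈ T
    · have hkT : k ∉ T := h.2 hfT
      have := hT f hfT k hkT
      rw [tri_big_left _ _ _ _ _ _ big, one_mul, w4 k hk, w4 f big] at this
      exact lt_irrefl _ this
    · have hkT : k ∈ T := by
        by_contra h'
        exact hfT (h.1 h')
      have := hT k hkT f hfT
      rw [tri_big_left _ _ _ _ _ _ hk, one_mul, w4 k hk, w4 f big] at this
      exact lt_irrefl _ this
  have core := core_necessity p q t hp hq ht (u 0) (u 1) (u 2) (u 3) _ (hu 0) (hu 1) (hu 2) (hu 3)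
    (Finset.sum_nonneg fun k _ => hu _) hb1 hb2 (0 ∈ T) (1 ∈ T) (2 ∈ T) (3 ∈ T) (f ∈ T)
    (fun x y => d12.1 (hT _ x _ y)) (fun x y => e12.1 (hT _ x _ y))
    (fun x y => d23.1 (hT _ x _ y)) (fun x y => e23.1 (hT _ x _ y))
    (fun x y => d34.1 (hT _ x _ y)) (fun x y => e34.1 (hT _ x _ y))
    (fun x y => d15.1 (hT _ x _ y)) (fun x y => e15.1 (hT _ x _ y))
    (fun x y => d25.1 (hT _ x _ y)) (fun x y => e25.1 (hT _ x _ y))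
    (fun x y => d35.1 (hT _ x _ y)) (fun x y => e35.1 (hT _ x _ y))
    (fun x y => d45.1 (hT _ x _ y)) (fun x y => e45.1 (hT _ x _ y))
    (fun x y => d13.1 (hT _ x _ y)) (fun x y => e13.1 (hT _ x _ y))
    (fun x y => d14.1 (hT _ x _ y)) (fun x y => e14.1 (hT _ x _ y))
    (fun x y => d24.1 (hT _ x _ y)) (fun x y => e24.1 (hT _ x _ y))
  rcases core with ⟨c0, c1, c2, c3, c4⟩ | ⟨c0, c1, c2, c3, c4⟩
  · rcases fin_cases5 b with rfl | rfl | rfl | rfl | hk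
    · exact hb' c0
    · exact hb' c1
    · exact hb' c2
    · exact hb' c3
    · exact hb' ((htail b hk).2 c4)
  · rcases fin_cases5 a with rfl | rfl | rfl | rfl | hk
    · exact c0 ha
    · exact c1 ha
    · exact c2 ha
    · exact c3 ha
    · exact c4 ((htail a hk).1 ha)

/-- Theorem thtriangular: characterization for a 4-block
triangular perturbed consistent matrix, via monomial similarity. -/
theorem coneCols_subset_effSet_iff_triangular {m : ℕ}
    (R S : Matrix (Fin (m + 5)) (Fin (m + 5)) ℝ)
    (hR : IsReciprocal R) (hS : IsMonomial S)
    (a13 a14 a24 : ℝ) (h13 : 0 < a13) (h24 : 0 < a24) (h14 : 1 ≤ a14)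
    (hSA : ∀ i j : Fin (m + 5), (S * R * S⁻¹) i j =
      if h : (i : ℕ) < 4 ∧ (j : ℕ) < 4 then
        !![1, 1, a13, a14; 1, 1, 1, a24; 1 / a13, 1, 1, 1;
           1 / a14, 1 / a24, 1, 1] ⟨i, h.1⟩ ⟨j, h.2⟩
      else 1) :
    ConeCols R ⊆ EffSet R ↔
      (¬ (1 < a24 ∧ a24 < a14 ∧ a14 < a13) ∧ ¬ (a24 < 1 ∧ 1 < a13 ∧ a13 < a14)) := by
  have hA : S * R * S⁻¹ = Tri m a13 a14 a24 := by
    ext i j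
    rw [hSA i j]
    rfl
  rw [coneCols_subset_iff R hR, monomial_transfer R S _ hS hA]
  constructor
  · intro h
    constructor
    · rintro ⟨x, y, z⟩
      obtain ⟨u, hu, hne, hc⟩ := cut_case1 m a13 a14 a24 x y z
      exact h u hu hne hc
    · rintro ⟨x, y, z⟩
      obtain ⟨u, hu, hne, hc⟩ := cut_case2 m a13 a14 a24 h24 x y z
      exact h u hu hne hc
  · rintro ⟨hb1, hb2⟩ u hu _
    exact tri_no_cut m a13 a14 a24 h13 h14 h24 hb1 hb2 u hu
end

section
/- Let R = [r_ij] be an n×n reciprocal matrix that is a double perturbed consistent matrix, i.e., there exists a positive vector w ∈ ℝⁿ such that the set of pairs (i,j) with i < j and r_ij ≠ w_i/w_j has at most two elements. Then C(R) ⊆ E(R). -/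
open Matrix

/-- The sum structure of a row with at most one non-unit entry. -/
lemma row_one {n : ℕ} (p : Fin n → Fin n → ℝ) (u : Fin n → ℝ) (i b : Fin n)
    (h : ∀ j, j ≠ b → p i j = 1) :
    ∑ j, p i j * u j = ∑ j, u j + (p i b - 1) * u b := by
  have : ∑ j, (p i j * u j - u j) = (p i b - 1) * u b := by
    rw [Finset.sum_eq_single b]
    · ring
    · intro j _ hj; rw [h j hj]; ring
    · simp
  rw [Finset.sum_sub_distrib] at this
  linarith

/-- The sum structure of a row with at most two non-unit entries. -/
lemma row_two {n : ℕ} (p : Fin n → Fin n → ℝ) (u : Fin n → ℝ) (i b c : Fin n) (hbc : b ≠ c)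
    (h : ∀ j, j ≠ b → j ≠ c → p i j = 1) :
    ∑ j, p i j * u j = ∑ j, u j + (p i b - 1) * u b + (p i c - 1) * u c := by
  have : ∑ j, (p i j * u j - u j) = (p i b - 1) * u b + (p i c - 1) * u c := by
    rw [Fintype.sum_eq_add b c hbc]
    · ring
    · rintro j ⟨hj, hj'⟩; rw [h j hj hj']; ring
  rw [Finset.sum_sub_distrib] at this
  linarith

lemma sum_ge_two {n : ℕ} (u : Fin n → ℝ) (hu : ∀ i, 0 ≤ u i) (a b : Fin n) (hab : a ≠ b) :
    u a + u b ≤ ∑ j, u j := by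
  rw [← Finset.sum_pair hab]
  exact Finset.sum_le_sum_of_subset_of_nonneg (Finset.subset_univ _) (fun i _ _ => hu i)

lemma sum_ge_three {n : ℕ} (u : Fin n → ℝ) (hu : ∀ i, 0 ≤ u i) (a b c : Fin n) (hab : a ≠ b)
    (hac : a ≠ c) (hbc : b ≠ c) :
    u a + u b + u c ≤ ∑ j, u j := by
  have : ∑ j ∈ ({a, b, c} : Finset (Fin n)), u j = u a + u b + u c := by
    rw [Finset.sum_insert (by simp [hab, hac]), Finset.sum_pair hbc]; ring
  rw [← this]
  exact Finset.sum_le_sum_of_subset_of_nonneg (Finset.subset_univ _) (fun i _ _ => hu i)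

lemma sum_eq_three {n : ℕ} (u : Fin n → ℝ) (a b c : Fin n) (hab : a ≠ b)
    (hac : a ≠ c) (hbc : b ≠ c) (h : ∀ d, d = a ∨ d = b ∨ d = c) :
    ∑ j, u j = u a + u b + u c := by
  have : ∑ j ∈ ({a, b, c} : Finset (Fin n)), u j = u a + u b + u c := by
    rw [Finset.sum_insert (by simp [hab, hac]), Finset.sum_pair hbc]; ring
  rw [← this]
  congr 1
  ext d
  simpa using h d

lemma sum_eq_two {n : ℕ} (u : Fin n → ℝ) (a b : Fin n) (hab : a ≠ b)
    (h : ∀ d, d = a ∨ d = b) :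
    ∑ j, u j = u a + u b := by
  rw [← Finset.sum_pair hab]
  congr 1
  ext d
  simpa using h d

/-- One perturbed pair, oriented. -/
lemma core_single {n : ℕ} (p : Fin n → Fin n → ℝ) (hpos : ∀ i j, 0 < p i j)
    (hrec : ∀ i j, p i j * p j i = 1) (u W : Fin n → ℝ) (hu : ∀ i, 0 ≤ u i)
    (hW : ∀ i, W i = ∑ j, p i j * u j) (S : Set (Fin n)) (hS : ∃ i, i ∈ S) (hT : ∃ i, i ∉ S)
    (hcut : ∀ i ∈ S, ∀ j, j ∉ S → W i < p i j * W j)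
    (a b : Fin n) (hab : a ≠ b)
    (H : ∀ i j, p i j ≠ 1 → (i = a ∧ j = b) ∨ (i = b ∧ j = a))
    (hx : 1 ≤ p a b) : False := by
  have H' : ∀ i j, ¬ ((i = a ∧ j = b) ∨ (i = b ∧ j = a)) → p i j = 1 := by
    intro i j h; by_contra h'; exact h (H i j h')
  set U := ∑ j, u j with hU
  have hWa : W a = U + (p a b - 1) * u b := by
    rw [hW]; exact row_one p u a b (fun j hj => H' _ _ (by tauto))
  have hWb : W b = U + (p b a - 1) * u a := by
    rw [hW]; exact row_one p u b a (fun j hj => H' _ _ (by tauto))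
  have hWd : ∀ d, d ≠ a → d ≠ b → W d = U := by
    intro d h1 h2
    rw [hW, row_one p u d a (fun j hj => H' _ _ (by tauto)), H' d a (by tauto)]; ring
  have hr := hrec a b
  have hx' : p b a ≤ 1 := by nlinarith [hpos b a]
  have h2 := sum_ge_two u hu a b hab
  have ha := hu a
  have hb := hu b
  have e1 : U ≤ W a := by rw [hWa]; nlinarith
  have e2 : W b ≤ U := by rw [hWb]; nlinarith
  have key : p a b * W b = p a b * U + (1 - p a b) * u a := by
    rw [hWb]; linear_combination u a * hr
  by_cases hSa : a ∈ S <;> by_cases hSb : b ∈ S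
  · obtain ⟨d, hd⟩ := hT
    have hda : d ≠ a := by rintro rfl; exact hd hSa
    have hdb : d ≠ b := by rintro rfl; exact hd hSb
    have := hcut a hSa d hd
    rw [H' a d (by tauto), hWd d hda hdb] at this
    linarith
  · by_cases hd : ∃ d, d ≠ a ∧ d ≠ b
    · obtain ⟨d, hda, hdb⟩ := hd
      by_cases hSd : d ∈ S
      · have := hcut d hSd b hSb
        rw [H' d b (by tauto), hWd d hda hdb] at this
        linarith
      · have := hcut a hSa d hSd
        rw [H' a d (by tauto), hWd d hda hdb] at this
        linarith
    · have := sum_eq_two u a b hab (by intro d; by_contra h; exact hd ⟨d, by tauto⟩)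
      have h3 := hcut a hSa b hSb
      rw [key, hWa] at h3
      rw [← hU] at this
      rw [this] at h3
      linarith
  · have h3 := hcut b hSb a hSa
    have h4 : p a b * W b < W a := by
      have := mul_lt_mul_of_pos_left h3 (hpos a b)
      rwa [← mul_assoc, hr, one_mul] at this
    rw [key, hWa] at h4
    nlinarith
  · obtain ⟨d, hd⟩ := hS
    have hda : d ≠ a := by rintro rfl; exact hSa hd
    have hdb : d ≠ b := by rintro rfl; exact hSb hd
    have := hcut d hd b hSb
    rw [H' d b (by tauto), hWd d hda hdb] at this
    linarith

/-- Two disjoint perturbed pairs, oriented. -/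
lemma core_disj {n : ℕ} (p : Fin n → Fin n → ℝ) (hpos : ∀ i j, 0 < p i j)
    (hrec : ∀ i j, p i j * p j i = 1) (u W : Fin n → ℝ) (hu : ∀ i, 0 ≤ u i)
    (hW : ∀ i, W i = ∑ j, p i j * u j) (S : Set (Fin n)) (hS : ∃ i, i ∈ S) (hT : ∃ i, i ∉ S)
    (hcut : ∀ i ∈ S, ∀ j, j ∉ S → W i < p i j * W j)
    (a b c d : Fin n) (hab : a ≠ b) (hcd : c ≠ d) (hac : a ≠ c) (had : a ≠ d) (hbc : b ≠ c)
    (hbd : b ≠ d)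
    (H : ∀ i j, p i j ≠ 1 → (i = a ∧ j = b) ∨ (i = b ∧ j = a) ∨ (i = c ∧ j = d) ∨ (i = d ∧ j = c))
    (hx : 1 ≤ p a b) (hy : 1 ≤ p c d) : False := by
  have H' : ∀ i j, ¬ ((i = a ∧ j = b) ∨ (i = b ∧ j = a) ∨ (i = c ∧ j = d) ∨ (i = d ∧ j = c)) →
      p i j = 1 := by
    intro i j h; by_contra h'; exact h (H i j h')
  set U := ∑ j, u j with hU
  have hWa : W a = U + (p a b - 1) * u b := by
    rw [hW]; exact row_one p u a b (fun j hj => H' _ _ (by tauto))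
  have hWb : W b = U + (p b a - 1) * u a := by
    rw [hW]; exact row_one p u b a (fun j hj => H' _ _ (by grind))
  have hWc : W c = U + (p c d - 1) * u d := by
    rw [hW]; exact row_one p u c d (fun j hj => H' _ _ (by grind))
  have hWd : W d = U + (p d c - 1) * u c := by
    rw [hW]; exact row_one p u d c (fun j hj => H' _ _ (by grind))
  have hWe : ∀ e, e ≠ a → e ≠ b → e ≠ c → e ≠ d → W e = U := by
    intro e h1 h2 h3 h4
    rw [hW, row_one p u e a (fun j hj => H' _ _ (by tauto)), H' e a (by tauto)]; ring
  have hr := hrec a b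
  have hs := hrec c d
  have hx' : p b a ≤ 1 := by nlinarith [hpos b a]
  have hy' : p d c ≤ 1 := by nlinarith [hpos d c]
  have h2 := sum_ge_two u hu a b hab
  have h2' := sum_ge_two u hu c d hcd
  have ha := hu a
  have hb := hu b
  have hc := hu c
  have hd := hu d
  have ea : U ≤ W a := by rw [hWa]; nlinarith
  have eb : W b ≤ U := by rw [hWb]; nlinarith
  have ec : U ≤ W c := by rw [hWc]; nlinarith
  have ed : W d ≤ U := by rw [hWd]; nlinarith
  -- the forbidden orientations
  have f1 : b ∈ S → a ∈ S := by
    intro hSb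
    by_contra hSa
    have h3 := hcut b hSb a hSa
    have h4 : p a b * W b < W a := by
      have := mul_lt_mul_of_pos_left h3 (hpos a b)
      rwa [← mul_assoc, hr, one_mul] at this
    have key : p a b * W b = p a b * U + (1 - p a b) * u a := by
      rw [hWb]; linear_combination u a * hr
    rw [key, hWa] at h4
    nlinarith
  have f2 : d ∈ S → c ∈ S := by
    intro hSb
    by_contra hSa
    have h3 := hcut d hSb c hSa
    have h4 : p c d * W d < W c := by
      have := mul_lt_mul_of_pos_left h3 (hpos c d)
      rwa [← mul_assoc, hs, one_mul] at this
    have key : p c d * W d = p c d * U + (1 - p c d) * u c := by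
      rw [hWd]; linear_combination u c * hs
    rw [key, hWc] at h4
    nlinarith
  -- `W ≥ U` on the left and `W ≤ U` on the right is impossible for an unperturbed pair
  have g : ∀ i ∈ S, ∀ j, j ∉ S → p i j = 1 → U ≤ W i → W j ≤ U → False := by
    intro i hi j hj h1 h2 h3
    have := hcut i hi j hj
    rw [h1] at this
    linarith
  have pad := H' a d (by grind)
  have pcb := H' c b (by grind)
  have hE : ∀ e, (e ≠ a ∧ e ≠ b ∧ e ≠ c ∧ e ≠ d) ∨ e = a ∨ e = b ∨ e = c ∨ e = d := by
    intro e; tauto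
  by_cases hSa : a ∈ S
  · have hSd : d ∈ S := by
      by_contra hSd; exact g a hSa d hSd pad ea ed
    have hSc := f2 hSd
    have hSb : b ∈ S := by
      by_contra hSb; exact g c hSc b hSb pcb ec eb
    obtain ⟨e, he⟩ := hT
    rcases hE e with ⟨h1, h2, h3, h4⟩ | rfl | rfl | rfl | rfl
    · exact g a hSa e he (H' _ _ (by tauto)) ea (hWe e h1 h2 h3 h4).le
    all_goals tauto
  · have hSb : b ∉ S := fun h => hSa (f1 h)
    have hSc : c ∉ S := fun h => g c h b hSb pcb ec eb
    have hSd : d ∉ S := fun h => hSc (f2 h)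
    obtain ⟨e, he⟩ := hS
    rcases hE e with ⟨h1, h2, h3, h4⟩ | rfl | rfl | rfl | rfl
    · exact g e he b hSb (H' _ _ (by tauto)) (hWe e h1 h2 h3 h4).ge eb
    all_goals tauto

set_option maxHeartbeats 1000000 in
/-- Two perturbed pairs sharing a vertex `a`. -/
lemma core_shared {n : ℕ} (p : Fin n → Fin n → ℝ) (hpos : ∀ i j, 0 < p i j)
    (hrec : ∀ i j, p i j * p j i = 1) (u W : Fin n → ℝ) (hu : ∀ i, 0 ≤ u i)
    (hW : ∀ i, W i = ∑ j, p i j * u j) (S : Set (Fin n)) (hS : ∃ i, i ∈ S) (hT : ∃ i, i ∉ S)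
    (hcut : ∀ i ∈ S, ∀ j, j ∉ S → W i < p i j * W j)
    (a b c : Fin n) (hab : a ≠ b) (hac : a ≠ c) (hbc : b ≠ c)
    (H : ∀ i j, p i j ≠ 1 → (i = a ∧ j = b) ∨ (i = b ∧ j = a) ∨ (i = a ∧ j = c) ∨ (i = c ∧ j = a)) :
    False := by
  have H' : ∀ i j, ¬ ((i = a ∧ j = b) ∨ (i = b ∧ j = a) ∨ (i = a ∧ j = c) ∨ (i = c ∧ j = a)) →
      p i j = 1 := by
    intro i j h; by_contra h'; exact h (H i j h')
  have hU0 : ∃ U, U = ∑ j, u j := ⟨_, rfl⟩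
  obtain ⟨U, hU⟩ := hU0
  have hWa : W a = U + (p a b - 1) * u b + (p a c - 1) * u c := by
    rw [hW, hU]; exact row_two p u a b c hbc (fun j hj hj' => H' _ _ (by tauto))
  have hWb : W b = U + (p b a - 1) * u a := by
    rw [hW, hU]; exact row_one p u b a (fun j hj => H' _ _ (by grind))
  have hWc : W c = U + (p c a - 1) * u a := by
    rw [hW, hU]; exact row_one p u c a (fun j hj => H' _ _ (by grind))
  have hWe : ∀ e, e ≠ a → e ≠ b → e ≠ c → W e = U := by
    intro e h1 h2 h3
    rw [hW, hU, row_one p u e a (fun j hj => H' _ _ (by tauto)), H' e a (by tauto)]; ring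
  have hP : ∀ e, e ≠ a → e ≠ b → e ≠ c → ∀ j, p e j = 1 ∧ p j e = 1 := by
    intro e h1 h2 h3 j
    exact ⟨H' _ _ (by tauto), H' _ _ (by tauto)⟩
  have hr := hrec a b
  have hs := hrec a c
  have keyb : p a b * W b = p a b * U + (1 - p a b) * u a := by
    rw [hWb]; linear_combination u a * hr
  have keyc : p a c * W c = p a c * U + (1 - p a c) * u a := by
    rw [hWc]; linear_combination u a * hs
  have pbc := H' b c (by grind)
  have pcb := H' c b (by grind)
  have ha := hu a
  have hb := hu b
  have hc := hu c
  have h3 := sum_ge_three u hu a b c hab hac hbc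
  rw [← hU] at h3
  have hor : (∃ e, e ≠ a ∧ e ≠ b ∧ e ≠ c ∧ W e = U) ∨
      (U = u a + u b + u c ∧ ∀ e, e = a ∨ e = b ∨ e = c) := by
    by_cases he : ∃ e, e ≠ a ∧ e ≠ b ∧ e ≠ c
    · obtain ⟨e, h1, h2, h3⟩ := he
      left
      exact ⟨e, h1, h2, h3, hWe e h1 h2 h3⟩
    · right
      have : ∀ e, e = a ∨ e = b ∨ e = c := by
        intro e
        by_contra h
        push Not at h
        exact he ⟨e, h.1, h.2.1, h.2.2⟩
      exact ⟨hU ▸ sum_eq_three u a b c hab hac hbc this, this⟩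
  have xb : p b a = 1 / p a b := by
    have := (hpos a b).ne'; field_simp; linarith
  have xc : p c a = 1 / p a c := by
    have := (hpos a c).ne'; field_simp; linarith
  have hx := hpos a b
  have hy := hpos a c
  have hx' := hpos b a
  have hy' := hpos c a
  have bge : p a b ≤ 1 → U ≤ W b := by
    intro h; rw [hWb]; nlinarith
  have ble : 1 ≤ p a b → W b ≤ U := by
    intro h; rw [hWb]; nlinarith
  have cge : p a c ≤ 1 → U ≤ W c := by
    intro h; rw [hWc]; nlinarith
  have cle : 1 ≤ p a c → W c ≤ U := by
    intro h; rw [hWc]; nlinarith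
  have age : 1 ≤ p a b → 1 ≤ p a c → U ≤ W a := by
    intro h h'; rw [hWa]; nlinarith
  have ale : p a b ≤ 1 → p a c ≤ 1 → W a ≤ U := by
    intro h h'; rw [hWa]; nlinarith
  have bltc : W b < W c → p a c < p a b := by
    intro h
    rw [hWb, hWc] at h
    by_contra hh
    push Not at hh
    have : p c a ≤ p b a := by rw [xb, xc]; exact one_div_le_one_div_of_le hx hh
    nlinarith
  have cltb : W c < W b → p a b < p a c := by
    intro h
    rw [hWb, hWc] at h
    by_contra hh
    push Not at hh
    have : p b a ≤ p c a := by rw [xb, xc]; exact one_div_le_one_div_of_le hy hh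
    nlinarith
  have cb : ∀ i ∈ S, ∀ j, j ∉ S → p i j = 1 → W i < W j := by
    intro i hi j hj h
    have := hcut i hi j hj
    rwa [h, one_mul] at this
  have Lb : a ∈ S → b ∉ S →
      (p a c - 1) * u c < (p a b - 1) * (U - u a - u b) := by
    intro h h'
    have := hcut a h b h'
    rw [keyb, hWa] at this
    linarith
  have Lc : a ∈ S → c ∉ S →
      (p a b - 1) * u b < (p a c - 1) * (U - u a - u c) := by
    intro h h'
    have := hcut a h c h'
    rw [keyc, hWa] at this
    linarith
  have Mb : b ∈ S → a ∉ S →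
      (p a b - 1) * (U - u a - u b) < (p a c - 1) * u c := by
    intro h h'
    have h4 := mul_lt_mul_of_pos_left (hcut b h a h') hx
    rw [← mul_assoc, hr, one_mul, keyb, hWa] at h4
    linarith
  have Mc : c ∈ S → a ∉ S →
      (p a c - 1) * (U - u a - u c) < (p a b - 1) * u b := by
    intro h h'
    have h4 := mul_lt_mul_of_pos_left (hcut c h a h') hy
    rw [← mul_assoc, hs, one_mul, keyc, hWa] at h4
    linarith
  by_cases hSa : a ∈ S <;> by_cases hSb : b ∈ S <;> by_cases hSc : c ∈ S
  · -- all in S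
    obtain ⟨e, he⟩ := hT
    have e1 : e ≠ a := fun h => he (h ▸ hSa)
    have e2 : e ≠ b := fun h => he (h ▸ hSb)
    have e3 : e ≠ c := fun h => he (h ▸ hSc)
    have k1 := cb a hSa e he (hP e e1 e2 e3 _).2
    have k2 := cb b hSb e he (hP e e1 e2 e3 _).2
    have k3 := cb c hSc e he (hP e e1 e2 e3 _).2
    rw [hWe e e1 e2 e3] at k1 k2 k3
    have x1 : 1 ≤ p a b := by by_contra h; linarith [bge (by linarith)]
    have y1 : 1 ≤ p a c := by by_contra h; linarith [cge (by linarith)]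
    linarith [age x1 y1]
  · have k := bltc (cb b hSb c hSc pbc)
    have l := Lc hSa hSc
    by_cases y1 : 1 ≤ p a c
    · rcases hor with ⟨e, e1, e2, e3, he⟩ | ⟨h, _⟩
      · by_cases hSe : e ∈ S
        · have := cb e hSe c hSc (hP e e1 e2 e3 _).1
          linarith [cle y1]
        · have := cb a hSa e hSe (hP e e1 e2 e3 _).2
          linarith [age (by linarith) y1]
      · rw [h] at l; nlinarith
    · push Not at y1
      nlinarith
  · have k := cltb (cb c hSc b hSb pcb)
    have l := Lb hSa hSb
    by_cases y1 : 1 ≤ p a b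
    · rcases hor with ⟨e, e1, e2, e3, he⟩ | ⟨h, _⟩
      · by_cases hSe : e ∈ S
        · have := cb e hSe b hSb (hP e e1 e2 e3 _).1
          linarith [ble y1]
        · have := cb a hSa e hSe (hP e e1 e2 e3 _).2
          linarith [age y1 (by linarith)]
      · rw [h] at l; nlinarith
    · push Not at y1
      nlinarith
  · have l := Lb hSa hSb
    have l' := Lc hSa hSc
    rcases hor with ⟨e, e1, e2, e3, he⟩ | ⟨h, _⟩
    · by_cases x1 : 1 ≤ p a b <;> by_cases y1 : 1 ≤ p a c
      · by_cases hSe : e ∈ S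
        · have := cb e hSe b hSb (hP e e1 e2 e3 _).1
          linarith [ble x1]
        · have := cb a hSa e hSe (hP e e1 e2 e3 _).2
          linarith [age x1 y1]
      · push Not at y1; nlinarith
      · push Not at x1; nlinarith
      · push Not at x1 y1
        have q1 : p a c < p a b := by nlinarith
        have q2 : p a b < p a c := by nlinarith
        linarith
    · rw [h] at l l'
      have q1 : p a c < p a b := by nlinarith
      have q2 : p a b < p a c := by nlinarith
      linarith
  · have l := Mb hSb hSa
    have l' := Mc hSc hSa
    rcases hor with ⟨e, e1, e2, e3, he⟩ | ⟨h, _⟩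
    · by_cases x1 : p a b ≤ 1 <;> by_cases y1 : p a c ≤ 1
      · by_cases hSe : e ∈ S
        · have := cb e hSe a hSa (hP e e1 e2 e3 _).1
          linarith [ale x1 y1]
        · have := cb b hSb e hSe (hP e e1 e2 e3 _).2
          linarith [bge x1]
      · push Not at y1; nlinarith
      · push Not at x1; nlinarith
      · push Not at x1 y1
        have q1 : p a b < p a c := by nlinarith
        have q2 : p a c < p a b := by nlinarith
        linarith
    · rw [h] at l l'
      have q1 : p a b < p a c := by nlinarith
      have q2 : p a c < p a b := by nlinarith
      linarith
  · have k := bltc (cb b hSb c hSc pbc)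
    have l := Mb hSb hSa
    by_cases y1 : p a b ≤ 1
    · rcases hor with ⟨e, e1, e2, e3, he⟩ | ⟨h, _⟩
      · by_cases hSe : e ∈ S
        · have := cb e hSe a hSa (hP e e1 e2 e3 _).1
          linarith [ale y1 (by linarith)]
        · have := cb b hSb e hSe (hP e e1 e2 e3 _).2
          linarith [bge y1]
      · rw [h] at l; nlinarith
    · push Not at y1
      nlinarith
  · have k := cltb (cb c hSc b hSb pcb)
    have l := Mc hSc hSa
    by_cases y1 : p a c ≤ 1
    · rcases hor with ⟨e, e1, e2, e3, he⟩ | ⟨h, _⟩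
      · by_cases hSe : e ∈ S
        · have := cb e hSe a hSa (hP e e1 e2 e3 _).1
          linarith [ale (by linarith) y1]
        · have := cb c hSc e hSe (hP e e1 e2 e3 _).2
          linarith [cge y1]
      · rw [h] at l; nlinarith
    · push Not at y1
      nlinarith
  · obtain ⟨e, he⟩ := hS
    have e1 : e ≠ a := fun h => hSa (h ▸ he)
    have e2 : e ≠ b := fun h => hSb (h ▸ he)
    have e3 : e ≠ c := fun h => hSc (h ▸ he)
    have k1 := cb e he a hSa (hP e e1 e2 e3 _).1
    have k2 := cb e he b hSb (hP e e1 e2 e3 _).1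
    have k3 := cb e he c hSc (hP e e1 e2 e3 _).1
    rw [hWe e e1 e2 e3] at k1 k2 k3
    have x1 : p a b ≤ 1 := by by_contra h; linarith [ble (by linarith)]
    have y1 : p a c ≤ 1 := by by_contra h; linarith [cle (by linarith)]
    linarith [ale x1 y1]

/-- Normalized cut lemma. -/
lemma core_cut {n : ℕ} (p : Fin n → Fin n → ℝ) (hpos : ∀ i j, 0 < p i j)
    (hrec : ∀ i j, p i j * p j i = 1) (u W : Fin n → ℝ) (hu : ∀ i, 0 ≤ u i)
    (hW : ∀ i, W i = ∑ j, p i j * u j) (S : Set (Fin n)) (hS : ∃ i, i ∈ S) (hT : ∃ i, i ∉ S)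
    (hcut : ∀ i ∈ S, ∀ j, j ∉ S → W i < p i j * W j)
    (hcard : Set.ncard {q : Fin n × Fin n | q.1 < q.2 ∧ p q.1 q.2 ≠ 1} ≤ 2) : False := by
  have ge1 : ∀ i j, 1 ≤ p i j ∨ 1 ≤ p j i := by
    intro i j
    by_contra h
    push Not at h
    nlinarith [hrec i j, hpos i j, hpos j i]
  have hne : ∀ i j, p i j ≠ 1 → p j i ≠ 1 := by
    intro i j h h'
    have := hrec i j
    rw [h', mul_one] at this
    exact h this
  have hdiag : ∀ i, p i i = 1 := by
    intro i; nlinarith [hrec i i, hpos i i]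
  have hmem : ∀ i j, p i j ≠ 1 → ((i, j) ∈ {q : Fin n × Fin n | q.1 < q.2 ∧ p q.1 q.2 ≠ 1} ∨
      (j, i) ∈ {q : Fin n × Fin n | q.1 < q.2 ∧ p q.1 q.2 ≠ 1}) := by
    intro i j h
    rcases lt_trichotomy i j with h1 | h1 | h1
    · exact Or.inl ⟨h1, h⟩
    · subst h1; exact absurd (hdiag i) h
    · exact Or.inr ⟨h1, hne _ _ h⟩
  have single : ∀ a b, a ≠ b → (∀ i j, p i j ≠ 1 → (i = a ∧ j = b) ∨ (i = b ∧ j = a)) → False := by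
    intro a b hab H
    rcases ge1 a b with h | h
    · exact core_single p hpos hrec u W hu hW S hS hT hcut a b hab H h
    · exact core_single p hpos hrec u W hu hW S hS hT hcut b a hab.symm
        (fun i j h => (H i j h).symm) h
  have hlt : ∀ q ∈ {q : Fin n × Fin n | q.1 < q.2 ∧ p q.1 q.2 ≠ 1}, q.1 < q.2 := fun q hq => hq.1
  generalize {q : Fin n × Fin n | q.1 < q.2 ∧ p q.1 q.2 ≠ 1} = s at *
  have : s.ncard = 0 ∨ s.ncard = 1 ∨ s.ncard = 2 := by omega
  rcases this with h0 | h1 | h2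
  · rw [Set.ncard_eq_zero] at h0
    subst h0
    obtain ⟨a, ha⟩ := hS
    obtain ⟨b, hb⟩ := hT
    refine single a b (by rintro rfl; exact hb ha) ?_
    intro i j h
    rcases hmem i j h with h | h <;> exact absurd h (Set.notMem_empty _)
  · rw [Set.ncard_eq_one] at h1
    obtain ⟨⟨a, b⟩, rfl⟩ := h1
    have hab : a < b := hlt (a, b) rfl
    refine single a b hab.ne ?_
    intro i j h
    have := hmem i j h
    simp only [Set.mem_singleton_iff, Prod.mk.injEq] at this
    tauto
  · rw [Set.ncard_eq_two] at h2
    obtain ⟨⟨a, b⟩, ⟨c, d⟩, hne', rfl⟩ := h2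
    have hab : a < b := hlt (a, b) (by simp)
    have hcd : c < d := hlt (c, d) (by simp)
    have H : ∀ i j, p i j ≠ 1 →
        (i = a ∧ j = b) ∨ (i = b ∧ j = a) ∨ (i = c ∧ j = d) ∨ (i = d ∧ j = c) := by
      intro i j h
      have := hmem i j h
      simp only [Set.mem_insert_iff, Set.mem_singleton_iff, Prod.mk.injEq] at this
      tauto
    simp only [ne_eq, Prod.mk.injEq] at hne'
    by_cases hac : a = c
    · subst hac
      exact core_shared p hpos hrec u W hu hW S hS hT hcut a b d hab.ne hcd.ne (by tauto) H
    by_cases had : a = d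
    · subst had
      exact core_shared p hpos hrec u W hu hW S hS hT hcut a b c hab.ne hcd.ne' (hcd.trans hab).ne'
        (fun i j h => by have := H i j h; tauto)
    by_cases hbc : b = c
    · subst hbc
      exact core_shared p hpos hrec u W hu hW S hS hT hcut b a d hab.ne' hcd.ne had
        (fun i j h => by have := H i j h; tauto)
    by_cases hbd : b = d
    · subst hbd
      exact core_shared p hpos hrec u W hu hW S hS hT hcut b a c hab.ne' hcd.ne' hac
        (fun i j h => by have := H i j h; tauto)
    rcases ge1 a b with h1 | h1 <;> rcases ge1 c d with h2 | h2
    · exact core_disj p hpos hrec u W hu hW S hS hT hcut a b c d hab.ne hcd.ne hac had hbc hbd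
        (fun i j h => by have := H i j h; tauto) h1 h2
    · exact core_disj p hpos hrec u W hu hW S hS hT hcut a b d c hab.ne hcd.ne' had hac hbd hbc
        (fun i j h => by have := H i j h; tauto) h1 h2
    · exact core_disj p hpos hrec u W hu hW S hS hT hcut b a c d hab.ne' hcd.ne hbc hbd hac had
        (fun i j h => by have := H i j h; tauto) h1 h2
    · exact core_disj p hpos hrec u W hu hW S hS hT hcut b a d c hab.ne' hcd.ne' hbd hbc had hac
        (fun i j h => by have := H i j h; tauto) h1 h2

/-- for a double perturbed consistent matrix, the cone
generated by the columns consists of efficient vectors. -/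
theorem coneCols_subset_effSet_double_perturbed {n : ℕ}
    (R : Matrix (Fin n) (Fin n) ℝ) (hR : IsReciprocal R)
    (h : ∃ w : Fin n → ℝ, (∀ i, 0 < w i) ∧
      Set.ncard {p : Fin n × Fin n | p.1 < p.2 ∧ R p.1 p.2 ≠ w p.1 / w p.2} ≤ 2) :
    ConeCols R ⊆ EffSet R := by
  obtain ⟨g, hg, hcard⟩ := h
  obtain ⟨hRpos, hRrec⟩ := hR
  rintro w ⟨hw0, u, hu, hwu⟩
  have hwi : ∀ i, w i = ∑ j, R i j * u j := by
    intro i; rw [hwu]; rfl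
  have hwpos : ∀ i, 0 < w i := by
    have : ∃ k, 0 < u k := by
      by_contra h
      push Not at h
      apply hw0
      funext i
      rw [hwi]
      apply Finset.sum_eq_zero
      intro j _
      rw [le_antisymm (h j) (hu j), mul_zero]
    obtain ⟨k, hk⟩ := this
    intro i
    rw [hwi]
    exact Finset.sum_pos' (fun j _ => mul_nonneg (hRpos i j).le (hu j))
      ⟨k, Finset.mem_univ _, mul_pos (hRpos i k) hk⟩
  refine ⟨hwpos, ?_⟩
  intro v hv hle
  -- an edge of the digraph gives monotonicity of `v / w`
  have edge : ∀ i j, R i j * w j ≤ w i → v i / w i ≤ v j / w j := by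
    intro i j h
    have h1 : R i j ≤ w i / w j := by rwa [le_div_iff₀ (hwpos j)]
    have h2 := hle i j
    rw [abs_of_nonpos (by linarith : R i j - w i / w j ≤ 0)] at h2
    have h3 : v i / v j ≤ w i / w j := by
      have := neg_le_of_abs_le h2
      linarith
    rw [div_le_div_iff₀ (hv j) (hwpos j)] at h3
    rw [div_le_div_iff₀ (hwpos i) (hwpos j)]
    linarith
  rcases isEmpty_or_nonempty (Fin n) with hn | hn
  · exact ⟨1, funext fun i => (hn.false i).elim⟩
  obtain ⟨m, hm⟩ := Finite.exists_max (fun i => v i / w i)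
  refine ⟨v m / w m, ?_⟩
  by_cases hall : ∀ i, v i / w i = v m / w m
  · funext i
    have := hall i
    simp only [Pi.smul_apply, smul_eq_mul]
    rw [← this, div_mul_cancel₀ _ (hwpos i).ne']
  exfalso
  push Not at hall
  refine core_cut (fun i j => R i j * g j / g i)
    (fun i j => div_pos (mul_pos (hRpos i j) (hg j)) (hg i)) ?_ (fun j => u j / g j)
    (fun i => w i / g i) (fun i => div_nonneg (hu i) (hg i).le) ?_
    {i | v i / w i = v m / w m} ⟨m, rfl⟩ hall ?_ ?_
  · intro i j
    have h1 := (hg i).ne'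
    have h2 := (hg j).ne'
    have h3 := (hRpos i j).ne'
    change R i j * g j / g i * (R j i * g i / g j) = 1
    rw [hRrec i j]
    field_simp
  · intro i
    rw [hwi, Finset.sum_div]
    apply Finset.sum_congr rfl
    intro j _
    have h1 := (hg i).ne'
    have h2 := (hg j).ne'
    field_simp
  · intro i hi j hj
    have h : w i < R i j * w j := by
      by_contra h
      push Not at h
      have h1 := edge i j h
      have h2 := hm j
      change v i / w i = v m / w m at hi
      exact hj (le_antisymm h2 (hi ▸ h1))
    have h1 := hg i
    have h2 := (hg j).ne'
    have : R i j * g j / g i * (w j / g j) = R i j * w j / g i := by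
      field_simp
    change w i / g i < R i j * g j / g i * (w j / g j)
    rw [this]
    exact div_lt_div_of_pos_right h h1
  · have hset : {q : Fin n × Fin n | q.1 < q.2 ∧ R q.1 q.2 * g q.2 / g q.1 ≠ 1} =
        {p : Fin n × Fin n | p.1 < p.2 ∧ R p.1 p.2 ≠ g p.1 / g p.2} := by
      ext q
      have h1 := (hg q.1).ne'
      have h2 := (hg q.2).ne'
      change (q.1 < q.2 ∧ R q.1 q.2 * g q.2 / g q.1 ≠ 1) ↔ (q.1 < q.2 ∧ R q.1 q.2 ≠ g q.1 / g q.2)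
      rw [ne_eq, ne_eq, div_eq_one_iff_eq h1, eq_div_iff h2]
    change Set.ncard {q : Fin n × Fin n | q.1 < q.2 ∧ R q.1 q.2 * g q.2 / g q.1 ≠ 1} ≤ 2
    rw [hset]
    exact hcard
end

section
/- Let n ≥ 5 and let R be an n×n reciprocal matrix. Suppose S is an n×n monomial matrix such that A = S R S⁻¹ is the n×n reciprocal matrix whose leading 4×4 principal submatrix has rows (1, 1, a_13, a_14), (1, 1, 1, a_24), (1/a_13, 1, 1, 1), (1/a_14, 1/a_24, 1, 1) and all of whose other entries equal 1, where a_13, a_24 > 0 and a_14 ≥ 1. If neither (1 < a_24 < a_14 < a_13) nor (a_24 < 1 < a_13 < a_14) holds, then every positive eigenvector of R is efficient for R, and every positive eigenvector of R·Rᵀ is efficient for R. -/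
open Matrix

lemma core_scalar (a b c u1 u2 u3 u4 U x1 x2 x3 x4 x5 : ℝ)
    (ha : 0 < a) (hc : 0 < c) (hb : 1 ≤ b)
    (hu1 : 0 < u1) (hu2 : 0 < u2) (hu3 : 0 < u3) (hu4 : 0 < u4) (hU : 0 < U)
    (hA : ¬ (1 < c ∧ c < b ∧ b < a)) (hB : ¬ (c < 1 ∧ 1 < a ∧ a < b))
    (p15 : 0 ≤ (a-1)*u3+(b-1)*u4 → x1 ≤ x5) (n15 : (a-1)*u3+(b-1)*u4 ≤ 0 → x5 ≤ x1)
    (p25 : 0 ≤ (c-1)*u4 → x2 ≤ x5) (n25 : (c-1)*u4 ≤ 0 → x5 ≤ x2)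
    (p35 : 0 ≤ (1-a)*u1 → x3 ≤ x5) (n35 : (1-a)*u1 ≤ 0 → x5 ≤ x3)
    (p45 : 0 ≤ (1-b)*c*u1+(1-c)*b*u2 → x4 ≤ x5) (n45 : (1-b)*c*u1+(1-c)*b*u2 ≤ 0 → x5 ≤ x4)
    (p12 : 0 ≤ (a-1)*u3+(b-c)*u4 → x1 ≤ x2) (n12 : (a-1)*u3+(b-c)*u4 ≤ 0 → x2 ≤ x1)
    (p23 : 0 ≤ (a-1)*u1+a*(c-1)*u4 → x2 ≤ x3) (n23 : (a-1)*u1+a*(c-1)*u4 ≤ 0 → x3 ≤ x2)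
    (p34 : 0 ≤ (b-a)*c*u1+(c-1)*a*b*u2 → x3 ≤ x4) (n34 : (b-a)*c*u1+(c-1)*a*b*u2 ≤ 0 → x4 ≤ x3)
    (p13 : 0 ≤ (1-a)*(u2+U)+(b-a)*u4 → x1 ≤ x3) (n13 : (1-a)*(u2+U)+(b-a)*u4 ≤ 0 → x3 ≤ x1)
    (p24 : 0 ≤ (b-c)*u1+b*(1-c)*(u3+U) → x2 ≤ x4) (n24 : (b-c)*u1+b*(1-c)*(u3+U) ≤ 0 → x4 ≤ x2)
    (p14 : 0 ≤ (c-b)*u2+c*(a-b)*u3+c*(1-b)*U → x1 ≤ x4)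
    (n14 : (c-b)*u2+c*(a-b)*u3+c*(1-b)*U ≤ 0 → x4 ≤ x1) :
    x1 = x5 ∧ x2 = x5 ∧ x3 = x5 ∧ x4 = x5 := by
  have hb0 : 0 < b := by linarith
  have fin : (x1 ≤ x5 ∧ x2 ≤ x5 ∧ x3 ≤ x5 ∧ x4 ≤ x5) → (x5 ≤ x1 ∧ x5 ≤ x2 ∧ x5 ≤ x3 ∧ x5 ≤ x4) →
      x1 = x5 ∧ x2 = x5 ∧ x3 = x5 ∧ x4 = x5 := fun h k =>
    ⟨le_antisymm h.1 k.1, le_antisymm h.2.1 k.2.1, le_antisymm h.2.2.1 k.2.2.1,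
      le_antisymm h.2.2.2 k.2.2.2⟩
  -- nonnegativity of products, via signs of the factors
  have m1 : ∀ s t : ℝ, 0 ≤ s → 0 ≤ t → 0 ≤ s * t := fun s t => mul_nonneg
  have hb1 : 0 ≤ b - 1 := by linarith
  rcases lt_trichotomy a 1 with h | h | h
  · -- a < 1
    have e35 := p35 (by have := m1 (1-a) u1 (by linarith) hu1.le; linarith)
    have e13 := p13 (by
      have := m1 (1-a) (u2+U) (by linarith) (by linarith)
      have := m1 (b-a) u4 (by linarith) hu4.le
      linarith)
    rcases lt_or_ge c b with k | k
    · have e14 := n14 (by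
        have := m1 (b-c) u2 (by linarith) hu2.le
        have := m1 (c*(b-a)) u3 (m1 _ _ hc.le (by linarith)) hu3.le
        have := m1 (c*(b-1)) U (m1 _ _ hc.le (by linarith)) hU.le
        linarith)
      rcases le_or_gt c 1 with l | l
      · have e25 := n25 (by have := m1 (1-c) u4 (by linarith) hu4.le; linarith)
        have e24 := p24 (by
          have := m1 (b-c) u1 (by linarith) hu1.le
          have := m1 (b*(1-c)) (u3+U) (m1 _ _ hb0.le (by linarith)) (by linarith)
          linarith)
        apply fin <;> refine ⟨?_, ?_, ?_, ?_⟩ <;> linarith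
      · have e25 := p25 (by have := m1 (c-1) u4 (by linarith) hu4.le; linarith)
        have e45 := n45 (by
          have := m1 ((b-1)*c) u1 (m1 _ _ (by linarith) hc.le) hu1.le
          have := m1 ((c-1)*b) u2 (m1 _ _ (by linarith) hb0.le) hu2.le
          linarith)
        have key : x5 ≤ x2 := by
          by_contra hx
          have q12 : (a-1)*u3+(b-c)*u4 < 0 := by
            by_contra hh; exact hx (by linarith [p12 (not_lt.1 hh)])
          have q23 : 0 < (a-1)*u1+a*(c-1)*u4 := by
            by_contra hh; exact hx (by linarith [n23 (not_lt.1 hh)])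
          have q24 : 0 < (b-c)*u1+b*(1-c)*(u3+U) := by
            by_contra hh; exact hx (by linarith [n24 (not_lt.1 hh)])
          have s1 := mul_pos (mul_pos ha (sub_pos.2 l)) (neg_pos.2 q12)
          have s2 := mul_pos (sub_pos.2 k) q23
          have s3 := mul_pos (sub_pos.2 h) q24
          have s4 := mul_pos (mul_pos (mul_pos (sub_pos.2 l) (sub_pos.2 h)) hu3) (show 0 < b - a by linarith)
          have s5 := mul_pos (mul_pos (mul_pos (sub_pos.2 l) (sub_pos.2 h)) hU) hb0
          nlinarith
        apply fin <;> refine ⟨?_, ?_, ?_, ?_⟩ <;> linarith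
    · have c1 : 0 ≤ c - 1 := by linarith
      have e45 := n45 (by
          have := m1 ((b-1)*c) u1 (m1 _ _ (by linarith) hc.le) hu1.le
          have := m1 ((c-1)*b) u2 (m1 _ _ (by linarith) hb0.le) hu2.le
          linarith)
      have e24 := n24 (by
          have := m1 (c-b) u1 (by linarith) hu1.le
          have := m1 (b*(c-1)) (u3+U) (m1 _ _ hb0.le (by linarith)) (by linarith)
          linarith)
      have e12 := n12 (by
          have := m1 (1-a) u3 (by linarith) hu3.le
          have := m1 (c-b) u4 (by linarith) hu4.le
          linarith)
      have e25 := p25 (by have := m1 (c-1) u4 (by linarith) hu4.le; linarith)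
      apply fin <;> refine ⟨?_, ?_, ?_, ?_⟩ <;> linarith
  · -- a = 1
    subst h
    have e35 := p35 (by simp)
    have e53 := n35 (by simp)
    have e15 := p15 (by have := m1 (b-1) u4 hb1 hu4.le; linarith)
    rcases le_or_gt c 1 with l | l
    · have e25 := n25 (by have := m1 (1-c) u4 (by linarith) hu4.le; linarith)
      have e24 := p24 (by
          have := m1 (b-c) u1 (by linarith) hu1.le
          have := m1 (b*(1-c)) (u3+U) (m1 _ _ hb0.le (by linarith)) (by linarith)
          linarith)
      have e14 := n14 (by
        have := m1 (b-c) u2 (by linarith) hu2.le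
        have := m1 (c*(b-1)) u3 (m1 _ _ hc.le (by linarith)) hu3.le
        have := m1 (c*(b-1)) U (m1 _ _ hc.le (by linarith)) hU.le
        linarith)
      apply fin <;> refine ⟨?_, ?_, ?_, ?_⟩ <;> linarith
    · have e25 := p25 (by have := m1 (c-1) u4 (by linarith) hu4.le; linarith)
      have e45 := n45 (by
          have := m1 ((b-1)*c) u1 (m1 _ _ (by linarith) hc.le) hu1.le
          have := m1 ((c-1)*b) u2 (m1 _ _ (by linarith) hb0.le) hu2.le
          linarith)
      rcases le_or_gt b c with k | k
      · have e24 := n24 (by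
          have := m1 (c-b) u1 (by linarith) hu1.le
          have := m1 (b*(c-1)) (u3+U) (m1 _ _ hb0.le (by linarith)) (by linarith)
          linarith)
        have e12 := n12 (by
          have := m1 (c-b) u4 (by linarith) hu4.le
          linarith)
        apply fin <;> refine ⟨?_, ?_, ?_, ?_⟩ <;> linarith
      · have e14 := n14 (by
          have := m1 (b-c) u2 (by linarith) hu2.le
          have := m1 (c*(b-1)) u3 (m1 _ _ hc.le (by linarith)) hu3.le
          have := m1 (c*(b-1)) U (m1 _ _ hc.le (by linarith)) hU.le
          linarith)
        have e12 := p12 (by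
          have := m1 (b-c) u4 (by linarith) hu4.le
          linarith)
        apply fin <;> refine ⟨?_, ?_, ?_, ?_⟩ <;> linarith
  · -- a > 1
    have e15 := p15 (by
      have := m1 (a-1) u3 (by linarith) hu3.le
      have := m1 (b-1) u4 hb1 hu4.le; linarith)
    have e53 := n35 (by have := m1 (a-1) u1 (by linarith) hu1.le; linarith)
    rcases lt_or_ge c 1 with l | l
    · have hab : b ≤ a := by
        by_contra hh; exact hB ⟨l, h, not_le.1 hh⟩
      have e25 := n25 (by have := m1 (1-c) u4 (by linarith) hu4.le; linarith)
      have e24 := p24 (by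
          have := m1 (b-c) u1 (by linarith) hu1.le
          have := m1 (b*(1-c)) (u3+U) (m1 _ _ hb0.le (by linarith)) (by linarith)
          linarith)
      have e12 := p12 (by
          have := m1 (a-1) u3 (by linarith) hu3.le
          have := m1 (b-c) u4 (by linarith) hu4.le
          linarith)
      have e13 := n13 (by
        have := m1 (a-1) (u2+U) (by linarith) (by linarith)
        have := m1 (a-b) u4 (by linarith) hu4.le
        linarith)
      have e34 := n34 (by
        have := m1 ((a-b)*c) u1 (m1 _ _ (by linarith) hc.le) hu1.le
        have := m1 ((1-c)*a*b) u2 (m1 _ _ (m1 _ _ (by linarith) ha.le) hb0.le) hu2.le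
        linarith)
      apply fin <;> refine ⟨?_, ?_, ?_, ?_⟩ <;> linarith
    · have e25 := p25 (by have := m1 (c-1) u4 (by linarith) hu4.le; linarith)
      have e45 := n45 (by
          have := m1 ((b-1)*c) u1 (m1 _ _ (by linarith) hc.le) hu1.le
          have := m1 ((c-1)*b) u2 (m1 _ _ (by linarith) hb0.le) hu2.le
          linarith)
      have e23 := p23 (by
          have := m1 (a-1) u1 (by linarith) hu1.le
          have := m1 (a*(c-1)) u4 (m1 _ _ ha.le (by linarith)) hu4.le
          linarith)
      rcases le_or_gt b c with k | k
      · have e24 := n24 (by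
          have := m1 (c-b) u1 (by linarith) hu1.le
          have := m1 (b*(c-1)) (u3+U) (m1 _ _ hb0.le (by linarith)) (by linarith)
          linarith)
        rcases le_or_gt a b with j | j
        · have e34 := p34 (by
            have := m1 ((b-a)*c) u1 (m1 _ _ (by linarith) hc.le) hu1.le
            have := m1 ((c-1)*a*b) u2 (m1 _ _ (m1 _ _ (by linarith) ha.le) hb0.le) hu2.le
            linarith)
          have key : x5 ≤ x1 := by
            by_contra hx
            have q12 : 0 < (a-1)*u3+(b-c)*u4 := by
              by_contra hh; exact hx (by linarith [n12 (not_lt.1 hh)])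
            have q13 : 0 < (1-a)*(u2+U)+(b-a)*u4 := by
              by_contra hh; exact hx (by linarith [n13 (not_lt.1 hh)])
            have q14 : 0 < (c-b)*u2+c*(a-b)*u3+c*(1-b)*U := by
              by_contra hh; exact hx (by linarith [n14 (not_lt.1 hh)])
            have s1 := m1 (b-a) _ (sub_nonneg.2 j) q12.le
            have s2 := m1 (c-b) _ (sub_nonneg.2 k) q13.le
            have s3 := mul_pos (sub_pos.2 h) q14
            have s4 := m1 ((a-1)*(b-a)*u3) (c-1) (m1 _ _ (m1 _ _ (by linarith) (by linarith)) hu3.le) (by linarith)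
            have s5 := m1 ((a-1)*U) (c*(b-1)) (m1 _ _ (by linarith) hU.le) (m1 _ _ hc.le hb1)
            have s6 := m1 ((a-1)*U) (c-b) (m1 _ _ (by linarith) hU.le) (by linarith)
            nlinarith
          apply fin <;> refine ⟨?_, ?_, ?_, ?_⟩ <;> linarith
        · have e13 := n13 (by
            have := m1 (a-1) (u2+U) (by linarith) (by linarith)
            have := m1 (a-b) u4 (by linarith) hu4.le
            linarith)
          apply fin <;> refine ⟨?_, ?_, ?_, ?_⟩ <;> linarith
      · have e12 := p12 (by
          have := m1 (a-1) u3 (by linarith) hu3.le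
          have := m1 (b-c) u4 (by linarith) hu4.le
          linarith)
        rcases le_or_gt a b with j | j
        · have e14 := n14 (by
            have := m1 (b-c) u2 (by linarith) hu2.le
            have := m1 (c*(b-a)) u3 (m1 _ _ hc.le (by linarith)) hu3.le
            have := m1 (c*(b-1)) U (m1 _ _ hc.le (by linarith)) hU.le
            linarith)
          have e34 := p34 (by
            have := m1 ((b-a)*c) u1 (m1 _ _ (by linarith) hc.le) hu1.le
            have := m1 ((c-1)*a*b) u2 (m1 _ _ (m1 _ _ (by linarith) ha.le) hb0.le) hu2.le
            linarith)
          apply fin <;> refine ⟨?_, ?_, ?_, ?_⟩ <;> linarith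
        · -- here c = 1
          have c1 : c = 1 := by
            by_contra hne
            exact hA ⟨lt_of_le_of_ne l (Ne.symm hne), k, j⟩
          subst c1
          have e52 := n25 (by simp)
          have e13 := n13 (by
            have := m1 (a-1) (u2+U) (by linarith) (by linarith)
            have := m1 (a-b) u4 (by linarith) hu4.le
            linarith)
          have e34 := n34 (by
            have := m1 (a-b) u1 (by linarith) hu1.le
            linarith)
          apply fin <;> refine ⟨?_, ?_, ?_, ?_⟩ <;> linarith

lemma core_w (a b c u1 u2 u3 u4 U x1 x2 x3 x4 x5 w1 w2 w3 w4 w5 : ℝ)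
    (ha : 0 < a) (hc : 0 < c) (hb : 1 ≤ b)
    (hu1 : 0 < u1) (hu2 : 0 < u2) (hu3 : 0 < u3) (hu4 : 0 < u4) (hU : 0 < U)
    (hA : ¬ (1 < c ∧ c < b ∧ b < a)) (hB : ¬ (c < 1 ∧ 1 < a ∧ a < b))
    (hw1 : w1 = u1 + u2 + a * u3 + b * u4 + U)
    (hw2 : w2 = u1 + u2 + u3 + c * u4 + U)
    (hw3 : w3 = 1 / a * u1 + u2 + u3 + u4 + U)
    (hw4 : w4 = 1 / b * u1 + 1 / c * u2 + u3 + u4 + U)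
    (hw5 : w5 = u1 + u2 + u3 + u4 + U)
    (p15 : w5 ≤ w1 → x1 ≤ x5) (n15 : w1 ≤ w5 → x5 ≤ x1)
    (p25 : w5 ≤ w2 → x2 ≤ x5) (n25 : w2 ≤ w5 → x5 ≤ x2)
    (p35 : w5 ≤ w3 → x3 ≤ x5) (n35 : w3 ≤ w5 → x5 ≤ x3)
    (p45 : w5 ≤ w4 → x4 ≤ x5) (n45 : w4 ≤ w5 → x5 ≤ x4)
    (p12 : w2 ≤ w1 → x1 ≤ x2) (n12 : w1 ≤ w2 → x2 ≤ x1)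
    (p23 : w3 ≤ w2 → x2 ≤ x3) (n23 : w2 ≤ w3 → x3 ≤ x2)
    (p34 : w4 ≤ w3 → x3 ≤ x4) (n34 : w3 ≤ w4 → x4 ≤ x3)
    (p13 : a * w3 ≤ w1 → x1 ≤ x3) (n13 : w1 ≤ a * w3 → x3 ≤ x1)
    (p24 : c * w4 ≤ w2 → x2 ≤ x4) (n24 : w2 ≤ c * w4 → x4 ≤ x2)
    (p14 : b * w4 ≤ w1 → x1 ≤ x4) (n14 : w1 ≤ b * w4 → x4 ≤ x1) :
    x1 = x5 ∧ x2 = x5 ∧ x3 = x5 ∧ x4 = x5 := by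
  have hb0 : 0 < b := by linarith
  have key : ∀ s t L D : ℝ, 0 < D → s - t = L / D → ((0 ≤ L → t ≤ s) ∧ (L ≤ 0 → s ≤ t)) := by
    intro s t L D hD h
    refine ⟨fun hL => ?_, fun hL => ?_⟩
    · have := div_nonneg hL hD.le; linarith
    · have := div_nonpos_of_nonpos_of_nonneg hL hD.le; linarith
  have k15 := key w1 w5 ((a-1)*u3+(b-1)*u4) 1 one_pos (by subst_vars; ring)
  have k25 := key w2 w5 ((c-1)*u4) 1 one_pos (by subst_vars; ring)
  have k35 := key w3 w5 ((1-a)*u1) a ha (by subst_vars; field_simp; ring)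
  have k45 := key w4 w5 ((1-b)*c*u1+(1-c)*b*u2) (b*c) (by positivity) (by subst_vars; field_simp; ring)
  have k12 := key w1 w2 ((a-1)*u3+(b-c)*u4) 1 one_pos (by subst_vars; ring)
  have k23 := key w2 w3 ((a-1)*u1+a*(c-1)*u4) a ha (by subst_vars; field_simp; ring)
  have k34 := key w3 w4 ((b-a)*c*u1+(c-1)*a*b*u2) (a*b*c) (by positivity) (by subst_vars; field_simp; ring)
  have k13 := key w1 (a*w3) ((1-a)*(u2+U)+(b-a)*u4) 1 one_pos (by subst_vars; field_simp; ring)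
  have k24 := key w2 (c*w4) ((b-c)*u1+b*(1-c)*(u3+U)) b hb0 (by subst_vars; field_simp; ring)
  have k14 := key w1 (b*w4) ((c-b)*u2+c*(a-b)*u3+c*(1-b)*U) c hc (by subst_vars; field_simp; ring)
  exact core_scalar a b c u1 u2 u3 u4 U x1 x2 x3 x4 x5 ha hc hb hu1 hu2 hu3 hu4 hU hA hB
    (fun h => p15 (k15.1 h)) (fun h => n15 (k15.2 h))
    (fun h => p25 (k25.1 h)) (fun h => n25 (k25.2 h))
    (fun h => p35 (k35.1 h)) (fun h => n35 (k35.2 h))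
    (fun h => p45 (k45.1 h)) (fun h => n45 (k45.2 h))
    (fun h => p12 (k12.1 h)) (fun h => n12 (k12.2 h))
    (fun h => p23 (k23.1 h)) (fun h => n23 (k23.2 h))
    (fun h => p34 (k34.1 h)) (fun h => n34 (k34.2 h))
    (fun h => p13 (k13.1 h)) (fun h => n13 (k13.2 h))
    (fun h => p24 (k24.1 h)) (fun h => n24 (k24.2 h))
    (fun h => p14 (k14.1 h)) (fun h => n14 (k14.2 h))

/-- The perturbed matrix. -/
noncomputable def triA (m : ℕ) (a13 a14 a24 : ℝ) : Matrix (Fin (m + 5)) (Fin (m + 5)) ℝ :=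
  fun i j => if h : (i : ℕ) < 4 ∧ (j : ℕ) < 4 then
        !![1, 1, a13, a14; 1, 1, 1, a24; 1 / a13, 1, 1, 1;
           1 / a14, 1 / a24, 1, 1] ⟨i, h.1⟩ ⟨j, h.2⟩
      else 1

lemma core_A {m : ℕ} (a b c : ℝ) (ha : 0 < a) (hc : 0 < c) (hb : 1 ≤ b)
    (hA : ¬ (1 < c ∧ c < b ∧ b < a)) (hB : ¬ (c < 1 ∧ 1 < a ∧ a < b))
    (u w x : Fin (m + 5) → ℝ) (hu : ∀ i, 0 < u i)
    (hw : ∀ i, w i = ∑ j, triA m a b c i j * u j)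
    (hp : ∀ i j, triA m a b c i j * w j ≤ w i → x i ≤ x j)
    (hn : ∀ i j, w i ≤ triA m a b c i j * w j → x j ≤ x i) :
    ∀ i, x i = x 4 := by
  let i0 : Fin (m + 5) := ⟨0, by omega⟩
  let i1 : Fin (m + 5) := ⟨1, by omega⟩
  let i2 : Fin (m + 5) := ⟨2, by omega⟩
  let i3 : Fin (m + 5) := ⟨3, by omega⟩
  let i4 : Fin (m + 5) := ⟨4, by omega⟩
  let r : Fin (m + 1) → Fin (m + 5) := fun k => ⟨k + 4, by omega⟩
  have hsum : ∀ f : Fin (m + 5) → ℝ, ∑ j, f j = f i0 + f i1 + f i2 + f i3 + ∑ k, f (r k) := by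
    intro f
    rw [Fin.sum_univ_succ, Fin.sum_univ_succ, Fin.sum_univ_succ, Fin.sum_univ_succ]
    simp only [← add_assoc]
    rfl
  have hE : ∀ i j : Fin (m + 5), 4 ≤ (i : ℕ) → triA m a b c i j = 1 := by
    intro i j h
    unfold triA
    rw [dif_neg (by omega)]
  have hE' : ∀ i j : Fin (m + 5), 4 ≤ (j : ℕ) → triA m a b c i j = 1 := by
    intro i j h
    unfold triA
    rw [dif_neg (by omega)]
  have hr : ∀ i k, triA m a b c i (r k) = 1 := fun i k => hE' _ _ (by simp [r])
  have hU : 0 < ∑ k, u (r k) := Finset.sum_pos (fun k _ => hu _) ⟨0, Finset.mem_univ _⟩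
  have hbig : ∀ i : Fin (m + 5), 4 ≤ (i : ℕ) →
      w i = u i0 + u i1 + u i2 + u i3 + ∑ k, u (r k) := by
    intro i hi
    rw [hw, hsum]
    simp only [hE i _ hi, one_mul]
  have hw0 : w i0 = u i0 + u i1 + a * u i2 + b * u i3 + ∑ k, u (r k) := by
    rw [hw, hsum]; simp only [hr]; simp [triA, i0, i1, i2, i3]
  have hw1 : w i1 = u i0 + u i1 + u i2 + c * u i3 + ∑ k, u (r k) := by
    rw [hw, hsum]; simp only [hr]; simp [triA, i0, i1, i2, i3]
  have hw2 : w i2 = 1 / a * u i0 + u i1 + u i2 + u i3 + ∑ k, u (r k) := by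
    rw [hw, hsum]; simp only [hr]; simp [triA, i0, i1, i2, i3]
  have hw3 : w i3 = 1 / b * u i0 + 1 / c * u i1 + u i2 + u i3 + ∑ k, u (r k) := by
    rw [hw, hsum]; simp only [hr]; simp [triA, i0, i1, i2, i3]
  have e01 : triA m a b c i0 i1 = 1 := by simp [triA, i0, i1]
  have e12 : triA m a b c i1 i2 = 1 := by simp [triA, i1, i2]
  have e23 : triA m a b c i2 i3 = 1 := by simp [triA, i2, i3]
  have e02 : triA m a b c i0 i2 = a := by simp [triA, i0, i2]
  have e13 : triA m a b c i1 i3 = c := by simp [triA, i1, i3]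
  have e03 : triA m a b c i0 i3 = b := by simp [triA, i0, i3]
  have e4 : ∀ i, triA m a b c i i4 = 1 := fun i => hE' _ _ (by simp [i4])
  have main := core_w a b c (u i0) (u i1) (u i2) (u i3) (∑ k, u (r k))
    (x i0) (x i1) (x i2) (x i3) (x i4) (w i0) (w i1) (w i2) (w i3) (w i4)
    ha hc hb (hu _) (hu _) (hu _) (hu _) hU hA hB hw0 hw1 hw2 hw3 (hbig _ (by simp [i4]))
    (fun h => hp _ _ (by rw [e4]; linarith)) (fun h => hn _ _ (by rw [e4]; linarith))
    (fun h => hp _ _ (by rw [e4]; linarith)) (fun h => hn _ _ (by rw [e4]; linarith))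
    (fun h => hp _ _ (by rw [e4]; linarith)) (fun h => hn _ _ (by rw [e4]; linarith))
    (fun h => hp _ _ (by rw [e4]; linarith)) (fun h => hn _ _ (by rw [e4]; linarith))
    (fun h => hp _ _ (by rw [e01]; linarith)) (fun h => hn _ _ (by rw [e01]; linarith))
    (fun h => hp _ _ (by rw [e12]; linarith)) (fun h => hn _ _ (by rw [e12]; linarith))
    (fun h => hp _ _ (by rw [e23]; linarith)) (fun h => hn _ _ (by rw [e23]; linarith))
    (fun h => hp _ _ (by rw [e02]; linarith)) (fun h => hn _ _ (by rw [e02]; linarith))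
    (fun h => hp _ _ (by rw [e13]; linarith)) (fun h => hn _ _ (by rw [e13]; linarith))
    (fun h => hp _ _ (by rw [e03]; linarith)) (fun h => hn _ _ (by rw [e03]; linarith))
  have h44 : (4 : Fin (m + 5)) = i4 := by
    apply Fin.ext
    simp [i4]
  rw [h44]
  intro i
  by_cases hi : 4 ≤ (i : ℕ)
  · have hwe : w i = w i4 := by rw [hbig i hi, hbig i4 (by simp [i4])]
    exact le_antisymm (hp _ _ (by rw [e4]; linarith)) (hn _ _ (by rw [e4]; linarith))
  · have : i = i0 ∨ i = i1 ∨ i = i2 ∨ i = i3 := by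
      simp only [Fin.ext_iff, i0, i1, i2, i3]; omega
    obtain ⟨g0, g1, g2, g3⟩ := main
    rcases this with h | h | h | h <;> rw [h] <;> assumption

lemma monomial_entry {n : ℕ} (R S : Matrix (Fin n) (Fin n) ℝ) (σ : Equiv.Perm (Fin n))
    (d : Fin n → ℝ) (hd : ∀ i, 0 < d i) (hS : S = σ.permMatrix ℝ * Matrix.diagonal d)
    (i j : Fin n) :
    d (σ i) * R (σ i) (σ j) = (S * R * S⁻¹) i j * d (σ j) := by
  have hdet : IsUnit S.det := by
    rw [hS, Matrix.det_mul, Matrix.det_diagonal, Matrix.det_permutation]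
    refine IsUnit.mul ?_ ?_
    · exact (Units.isUnit _).map (Int.castRingHom ℝ)
    · exact (Finset.prod_pos (fun i _ => hd i)).ne'.isUnit
  have h : S * R = (S * R * S⁻¹) * S := by
    rw [Matrix.mul_assoc (S * R), Matrix.nonsing_inv_mul _ hdet, Matrix.mul_one]
  have hent : ∀ k l, S k l = if σ k = l then d l else 0 := by
    intro k l
    rw [hS, Matrix.mul_diagonal]
    simp [Equiv.Perm.permMatrix, PEquiv.toMatrix_apply, Equiv.toPEquiv_apply, eq_comm]
  have h2 := congrFun (congrFun h i) (σ j)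
  rw [Matrix.mul_apply, Matrix.mul_apply] at h2
  simpa [hent] using h2

lemma eff_of_cone {m : ℕ}
    (R S : Matrix (Fin (m + 5)) (Fin (m + 5)) ℝ)
    (hR : IsReciprocal R) (hS : IsMonomial S)
    (a b c : ℝ) (ha : 0 < a) (hc : 0 < c) (hb : 1 ≤ b)
    (hSA : S * R * S⁻¹ = triA m a b c)
    (hA : ¬ (1 < c ∧ c < b ∧ b < a)) (hB : ¬ (c < 1 ∧ 1 < a ∧ a < b))
    (v y : Fin (m + 5) → ℝ) (hv : ∀ i, 0 < v i) (hy : ∀ i, 0 < y i)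
    (hvy : ∀ i, v i = ∑ j, R i j * y j) : IsEfficient R v := by
  obtain ⟨σ, d, hd, hSd⟩ := hS
  have hent := monomial_entry R S σ d hd hSd
  rw [hSA] at hent
  refine ⟨hv, fun z hz hle => ?_⟩
  -- arcs for R
  have arc : ∀ i j, R i j * v j ≤ v i → z i / v i ≤ z j / v j := by
    intro i j h
    have h1 : R i j ≤ v i / v j := (le_div_iff₀ (hv j)).2 h
    have h2 := hle i j
    rw [abs_of_nonpos (by linarith : R i j - v i / v j ≤ 0)] at h2
    have h3 : z i / z j ≤ v i / v j := by linarith [neg_abs_le (R i j - z i / z j)]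
    rw [div_le_div_iff₀ (hz j) (hv j)] at h3
    rw [div_le_div_iff₀ (hv i) (hv j)]
    linarith
  have arc' : ∀ i j, v i ≤ R i j * v j → z j / v j ≤ z i / v i := by
    intro i j h
    apply arc
    rw [hR.2 i j, one_div, inv_mul_le_iff₀ (hR.1 i j)]
    exact h
  have res := core_A a b c ha hc hb hA hB (fun i => d (σ i) * y (σ i))
    (fun i => d (σ i) * v (σ i)) (fun i => z (σ i) / v (σ i))
    (fun i => mul_pos (hd _) (hy _))
    (by
      intro i
      rw [hvy, ← Equiv.sum_comp σ, Finset.mul_sum]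
      refine Finset.sum_congr rfl fun j _ => ?_
      rw [← mul_assoc, ← mul_assoc, hent])
    (by
      intro i j h
      apply arc
      rw [← mul_assoc, ← hent, mul_assoc] at h
      exact le_of_mul_le_mul_left h (hd _))
    (by
      intro i j h
      apply arc'
      rw [← mul_assoc, ← hent, mul_assoc] at h
      exact le_of_mul_le_mul_left h (hd _))
  refine ⟨z (σ 4) / v (σ 4), ?_⟩
  funext i
  have h := res (σ.symm i)
  simp only [Equiv.apply_symm_apply] at h
  rw [Pi.smul_apply, smul_eq_mul, ← h, div_mul_cancel₀ _ (hv i).ne']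

lemma eff_of_eig {m : ℕ}
    (R S : Matrix (Fin (m + 5)) (Fin (m + 5)) ℝ)
    (hR : IsReciprocal R) (hS : IsMonomial S)
    (a b c : ℝ) (ha : 0 < a) (hc : 0 < c) (hb : 1 ≤ b)
    (hSA : S * R * S⁻¹ = triA m a b c)
    (hA : ¬ (1 < c ∧ c < b ∧ b < a)) (hB : ¬ (c < 1 ∧ 1 < a ∧ a < b))
    (v y : Fin (m + 5) → ℝ) (hv : ∀ i, 0 < v i) (hy : ∀ i, 0 < y i) (lam : ℝ)
    (h : R.mulVec y = lam • v) : IsEfficient R v := by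
  have hi : ∀ i, ∑ j, R i j * y j = lam * v i := fun i => congrFun h i
  have hl : 0 < lam := by
    have h0 : 0 < lam * v 0 := by
      rw [← hi 0]
      exact Finset.sum_pos (fun j _ => mul_pos (hR.1 _ _) (hy _)) ⟨0, Finset.mem_univ _⟩
    exact pos_of_mul_pos_left h0 (hv 0).le
  refine eff_of_cone R S hR hS a b c ha hc hb hSA hA hB v (fun i => y i / lam) hv
    (fun i => div_pos (hy i) hl) fun i => ?_
  have : ∑ j, R i j * (y j / lam) = (∑ j, R i j * y j) / lam := by
    rw [Finset.sum_div]
    exact Finset.sum_congr rfl fun j _ => by ring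
  rw [this, hi, mul_div_cancel_left₀ _ hl.ne']

/-- Corollary corPerronsimple: efficiency of the Perron vector
and of the singular vector of a 4-block triangular perturbed consistent
matrix. -/
theorem perron_and_singular_efficient_triangular {m : ℕ}
    (R S : Matrix (Fin (m + 5)) (Fin (m + 5)) ℝ)
    (hR : IsReciprocal R) (hS : IsMonomial S)
    (a13 a14 a24 : ℝ) (h13 : 0 < a13) (h24 : 0 < a24) (h14 : 1 ≤ a14)
    (hSA : ∀ i j : Fin (m + 5), (S * R * S⁻¹) i j =
      if h : (i : ℕ) < 4 ∧ (j : ℕ) < 4 then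
        !![1, 1, a13, a14; 1, 1, 1, a24; 1 / a13, 1, 1, 1;
           1 / a14, 1 / a24, 1, 1] ⟨i, h.1⟩ ⟨j, h.2⟩
      else 1)
    (hcond : ¬ (1 < a24 ∧ a24 < a14 ∧ a14 < a13) ∧ ¬ (a24 < 1 ∧ 1 < a13 ∧ a13 < a14)) :
    (∀ v : Fin (m + 5) → ℝ, (∀ i, 0 < v i) →
        (∃ lam : ℝ, R.mulVec v = lam • v) → IsEfficient R v) ∧
    (∀ v : Fin (m + 5) → ℝ, (∀ i, 0 < v i) →
        (∃ lam : ℝ, (R * Rᵀ).mulVec v = lam • v) → IsEfficient R v) := by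
  have hA : S * R * S⁻¹ = triA m a13 a14 a24 := by
    ext i j
    rw [hSA i j]
    rfl
  refine ⟨fun v hv ⟨lam, h⟩ => ?_, fun v hv ⟨lam, h⟩ => ?_⟩
  · exact eff_of_eig R S hR hS a13 a14 a24 h13 h24 h14 hA hcond.1 hcond.2 v v hv hv lam h
  · refine eff_of_eig R S hR hS a13 a14 a24 h13 h24 h14 hA hcond.1 hcond.2 v (Rᵀ.mulVec v) hv
      (fun i => ?_) lam (by rw [Matrix.mulVec_mulVec]; exact h)
    have hp : 0 < ∑ j, R j i * v j :=
      Finset.sum_pos (fun j _ => mul_pos (hR.1 _ _) (hv _)) ⟨0, Finset.mem_univ _⟩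
    exact hp
end
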